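/- Let X be a compact metric space with finite Hausdorff n-measure, let Σ be a finite simplicial complex of dimension N ≥ n equipped with the ℓ²-metric, and let P ⊆ X be purely n-unrectifiable. Suppose φ : X → Σ is an L-Lipschitz map with H^n(φ(P)) ≤ ε. Then there exists a map p : Σ → Σ with p(Δ) ⊆ Δ for every simplex Δ of Σ such that p ∘ φ is Lipschitz with image contained in the n-skeleton Σ^n of Σ, H^n(p(φ(P))) ≤ C·ε, and for every n-dimensional simplex Δ of Σ one has ∫_Δ N(p ∘ φ, y) dH^n(y) ≤ C·H^n(φ⁻¹(st Δ)), where the constant C > 1 depends only on L, N and n. -/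

import Mathlib

open Set MeasureTheory Metric Filter
open scoped NNReal ENNReal Pointwise

noncomputable section

/-- The space ℓ^∞ of bounded real sequences with the supremum norm. -/
abbrev Linf : Type := lp (fun _ : ℕ => ℝ) ⊤

/-- Nagata dimension of `X` is at most `n` with constant `c`: for every `s > 0` there is
a covering of `X` by sets of diameter at most `c·s` such that every set of diameter
less than `s` meets at most `n+1` members of the covering. -/
def NagataDimLE (X : Type*) [MetricSpace X] (n : ℕ) (c : ℝ) : Prop :=
  ∀ s : ℝ, 0 < s → ∃ 𝒰 : Set (Set X),
    (⋃₀ 𝒰 = Set.univ) ∧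
    (∀ U ∈ 𝒰, EMetric.diam U ≤ ENNReal.ofReal (c * s)) ∧
    (∀ A : Set X, EMetric.diam A < ENNReal.ofReal s →
      ({U ∈ 𝒰 | (A ∩ U).Nonempty}).Finite ∧
      ({U ∈ 𝒰 | (A ∩ U).Nonempty}).ncard ≤ n + 1)

/-- An abstract finite simplicial complex on vertex set `I`:
a nonempty family of nonempty finite subsets of `I`, closed under nonempty subsets. -/
structure SimplicialCplx (I : Type*) where
  F : Finset (Finset I)
  F_nonempty : F.Nonempty
  mem_nonempty : ∀ S ∈ F, S.Nonempty
  down_closed : ∀ S ∈ F, ∀ T : Finset I, T ⊆ S → T.Nonempty → T ∈ F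

/-- The vertex `e_i` of the standard simplex in the Euclidean space `ℝ^I`. -/
def vertex {I : Type*} [Fintype I] [DecidableEq I] (i : I) : EuclideanSpace ℝ I :=
  EuclideanSpace.single i (1 : ℝ)

/-- The closed simplex `Δ_S = (ε/√2) · convexHull {e_i : i ∈ S}`,
a Euclidean simplex of side length `ε`. -/
def simplexOf {I : Type*} [Fintype I] [DecidableEq I] (ε : ℝ) (S : Finset I) :
    Set (EuclideanSpace ℝ I) :=
  (ε / Real.sqrt 2) • convexHull ℝ (vertex '' (S : Set I))

/-- The geometric realization of a simplicial complex with side length `ε`,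
as a subset of the Euclidean space `ℝ^I` (carrying the `ℓ²`-metric). -/
def realization {I : Type*} [Fintype I] [DecidableEq I] (ε : ℝ) (K : SimplicialCplx I) :
    Set (EuclideanSpace ℝ I) :=
  ⋃ S ∈ K.F, simplexOf ε S

/-- The `k`-skeleton of the realization: the union of the simplices on at most
`k+1` vertices. -/
def skeleton {I : Type*} [Fintype I] [DecidableEq I] (ε : ℝ) (K : SimplicialCplx I) (k : ℕ) :
    Set (EuclideanSpace ℝ I) :=
  ⋃ S ∈ K.F, ⋃ (_ : S.card ≤ k + 1), simplexOf ε S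

/-- The relative interior of the simplex with vertex set `S` (side length `ε`). -/
def openSimplexOf {I : Type*} [Fintype I] [DecidableEq I] (ε : ℝ) (S : Finset I) :
    Set (EuclideanSpace ℝ I) :=
  {x | ∃ t : I → ℝ, (∀ i ∈ S, 0 < t i) ∧ (∑ i ∈ S, t i) = 1 ∧
    x = (ε / Real.sqrt 2) • ∑ i ∈ S, t i • vertex i}

/-- The open star of the simplex with vertex set `S`: the union of the relative
interiors of the simplices of `K` having `S` as a face. -/
def openStar {I : Type*} [Fintype I] [DecidableEq I] (ε : ℝ) (K : SimplicialCplx I)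
    (S : Finset I) : Set (EuclideanSpace ℝ I) :=
  ⋃ T ∈ K.F, ⋃ (_ : S ⊆ T), openSimplexOf ε T

/-- `P` is purely `n`-unrectifiable: every Lipschitz image of a subset of `ℝⁿ`
meets `P` in a set of Hausdorff `n`-measure zero. -/
def PurelyUnrectifiable (n : ℕ) {X : Type*} [MetricSpace X] [MeasurableSpace X] [BorelSpace X]
    (P : Set X) : Prop :=
  ∀ (A : Set (EuclideanSpace ℝ (Fin n))) (φ : EuclideanSpace ℝ (Fin n) → X) (L : ℝ≥0),
    LipschitzOnWith L φ A → μH[(n : ℝ)] (P ∩ φ '' A) = 0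

/-- `f` is Lipschitz on each piece of a countable measurable cover of its domain, and the
measure `ω` dominates the sum of the `n`-dimensional Hausdorff measures of the pieces,
weighted by the `n`-th powers of the Lipschitz constants. -/
def PiecewiseDominated (n : ℕ) {Y Z : Type*} [MetricSpace Y] [MeasurableSpace Y] [BorelSpace Y]
    [MetricSpace Z] (f : Y → Z) (ω : Measure Y) : Prop :=
  ∃ (ι : Type) (_ : Countable ι) (E : ι → Set Y) (c : ι → ℝ≥0),
    (∀ i, MeasurableSet (E i)) ∧ (⋃ i, E i) = Set.univ ∧ (∀ i, LipschitzOnWith (c i) f (E i)) ∧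
    Measure.sum (fun i => (c i ^ n) • (μH[(n : ℝ)] : Measure Y).restrict (E i)) ≤ ω

section PiecewiseDominated

variable {n : ℕ} {Y Z W : Type*} [MetricSpace Y] [MeasurableSpace Y] [BorelSpace Y]
  [MetricSpace Z] [MetricSpace W]

theorem PiecewiseDominated.of_lipschitzWith {f : Y → Z} {K : ℝ≥0} (hf : LipschitzWith K f) :
    PiecewiseDominated n f ((K ^ n) • (μH[(n : ℝ)] : Measure Y)) := by
  refine ⟨Unit, inferInstance, fun _ => Set.univ, fun _ => K, by simp, iUnion_const _,
    fun _ => hf.lipschitzOnWith, ?_⟩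
  rw [Measure.le_iff]
  intro s hs
  simp

theorem PiecewiseDominated.comp [MeasurableSpace Z] {κ : Type} [Countable κ] {f : Y → Z}
    {g : Z → W} {ω : Measure Y} (h : PiecewiseDominated n f ω) (hf : Measurable f)
    {A : κ → Set Z} {d : κ → ℝ≥0} (hA : ∀ l, MeasurableSet (A l)) (hcov : ∀ y, ∃ l, f y ∈ A l)
    (hg : ∀ l, LipschitzOnWith (d l) g (A l)) :
    PiecewiseDominated n (g ∘ f) (Measure.sum fun l => (d l ^ n) • ω.restrict (f ⁻¹' A l)) := by
  obtain ⟨ι, hι, E, c, hE, hEc, hfE, hω⟩ := h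
  refine ⟨κ × ι, inferInstance, fun q => E q.2 ∩ f ⁻¹' A q.1, fun q => d q.1 * c q.2,
    fun q => (hE _).inter (hf (hA _)), ?_, ?_, ?_⟩
  · refine eq_univ_of_forall fun y => ?_
    obtain ⟨l, hl⟩ := hcov y
    obtain ⟨i, hi⟩ := mem_iUnion.1 (hEc ▸ mem_univ y)
    exact mem_iUnion.2 ⟨(l, i), hi, hl⟩
  · rintro ⟨l, i⟩
    exact (hg l).comp ((hfE i).mono inter_subset_left) fun y hy => hy.2
  · rw [Measure.le_iff] at hω ⊢
    intro s hs
    rw [Measure.sum_apply _ hs, Measure.sum_apply _ hs, ENNReal.tsum_prod' (f := fun q : κ × ι =>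
      (((d q.1 * c q.2) ^ n) • (μH[(n : ℝ)] : Measure Y).restrict (E q.2 ∩ f ⁻¹' A q.1)) s)]
    refine ENNReal.tsum_le_tsum fun l => ?_
    have h1 := hω _ (hs.inter (hf (hA l)))
    rw [Measure.sum_apply _ (hs.inter (hf (hA l)))] at h1
    simp only [Measure.smul_apply, Measure.restrict_apply hs,
      Measure.restrict_apply (hs.inter (hf (hA l))), ENNReal.smul_def, smul_eq_mul] at h1 ⊢
    refine le_trans (le_of_eq ?_) (mul_le_mul_right h1 _)
    rw [← ENNReal.tsum_mul_left]
    refine tsum_congr fun i => ?_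
    rw [mul_pow, ENNReal.coe_mul, mul_assoc]
    congr 3
    ext y
    simp only [mem_inter_iff]
    tauto

/-- A separable metric space has, at every scale, a countable measurable partition,
encoded by a measurable function, into pieces of small diameter. -/
theorem exists_measurable_nat_dist_lt [SecondCountableTopology Y] {r : ℝ} (hr : 0 < r) :
    ∃ q : Y → ℕ, Measurable q ∧ ∀ x y, q x = q y → dist x y < r := by
  classical
  rcases isEmpty_or_nonempty Y with hY | hY
  · exact ⟨fun _ => 0, measurable_const, fun x => hY.elim x⟩
  have hex : ∀ x : Y, ∃ i, dist x (TopologicalSpace.denseSeq Y i) < r / 2 := fun x => by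
    obtain ⟨i, hi⟩ := (TopologicalSpace.denseRange_denseSeq Y).exists_dist_lt x (half_pos hr)
    exact ⟨i, hi⟩
  refine ⟨fun x => Nat.find (hex x), measurable_find _ fun i => ?_, fun x y hxy => ?_⟩
  · exact (isOpen_lt (by fun_prop) (by fun_prop)).measurableSet
  · have hx := Nat.find_spec (hex x)
    have hy := Nat.find_spec (hex y)
    dsimp only at hxy
    rw [← hxy] at hy
    have := dist_triangle_right x y (TopologicalSpace.denseSeq Y (Nat.find (hex x)))
    linarith

variable [MeasurableSpace Z] [BorelSpace Z]

theorem PiecewiseDominated.hausdorffMeasure_range_le {f : Y → Z} {ω : Measure Y}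
    (h : PiecewiseDominated n f ω) : μH[(n : ℝ)] (Set.range f) ≤ ω Set.univ := by
  obtain ⟨ι, hι, E, c, hE, hEc, hfE, hω⟩ := h
  calc μH[(n : ℝ)] (Set.range f) = μH[(n : ℝ)] (⋃ i, f '' E i) := by
        rw [← image_iUnion, hEc, image_univ]
    _ ≤ ∑' i, μH[(n : ℝ)] (f '' E i) := measure_iUnion_le _
    _ ≤ ∑' i, ((c i ^ n) • (μH[(n : ℝ)] : Measure Y).restrict (E i)) Set.univ := by
        refine ENNReal.tsum_le_tsum fun i => ?_
        refine ((hfE i).hausdorffMeasure_image_le n.cast_nonneg).trans (le_of_eq ?_)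
        simp [ENNReal.smul_def]
    _ ≤ ω Set.univ := by
        rw [← Measure.sum_apply _ MeasurableSet.univ]
        exact hω _

/-- Eilenberg's inequality: the multiplicity function of a map which is Lipschitz on `E`
has a measurable majorant of integral at most `c ^ n * H^n(E)`. -/
theorem LipschitzOnWith.exists_measurable_encard_le [SecondCountableTopology Y] {f : Y → Z}
    {c : ℝ≥0} {E : Set Y} (hf : LipschitzOnWith c f E) (hE : MeasurableSet E) :
    ∃ h : Z → ℝ≥0∞, Measurable h ∧ (∀ z, ((E ∩ f ⁻¹' {z}).encard : ℝ≥0∞) ≤ h z) ∧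
      ∫⁻ z, h z ∂μH[(n : ℝ)] ≤ (c : ℝ≥0∞) ^ n * μH[(n : ℝ)] E := by
  classical
  choose q hqm hq using fun j : ℕ => exists_measurable_nat_dist_lt (Y := Y)
    (r := 1 / ((j : ℝ) + 1)) (by positivity)
  let H : ℕ → ℕ → Set Z := fun j i => toMeasurable μH[(n : ℝ)] (f '' (E ∩ q j ⁻¹' {i}))
  let h : ℕ → Z → ℝ≥0∞ := fun j z => ∑' i, (H j i).indicator (fun _ => 1) z
  have hHm : ∀ j i, MeasurableSet (H j i) := fun j i => measurableSet_toMeasurable _ _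
  have hm : ∀ j, Measurable (h j) := fun j =>
    Measurable.tsum fun i => measurable_const.indicator (hHm j i)
  refine ⟨fun z => liminf (fun j => h j z) atTop, Measurable.liminf hm, fun z => ?_, ?_⟩
  · have key : ∀ s : Finset Y, (s : Set Y) ⊆ E ∩ f ⁻¹' {z} →
        (s.card : ℝ≥0∞) ≤ liminf (fun j => h j z) atTop := by
      intro s hs
      obtain ⟨δ, hδ, hsep⟩ : ∃ δ > (0 : ℝ), ∀ x ∈ s, ∀ y ∈ s, x ≠ y → δ ≤ dist x y := by
        have := (s.finite_toSet).isClosed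
        by_cases hne : s.offDiag.Nonempty
        · obtain ⟨w, hw, hmin⟩ := s.offDiag.exists_min_image (fun w => dist w.1 w.2) hne
          refine ⟨dist w.1 w.2, dist_pos.2 (Finset.mem_offDiag.1 hw).2.2, fun x hx y hy hxy => ?_⟩
          exact hmin (x, y) (Finset.mem_offDiag.2 ⟨hx, hy, hxy⟩)
        · refine ⟨1, one_pos, fun x hx y hy hxy => (hne ⟨(x, y), ?_⟩).elim⟩
          exact Finset.mem_offDiag.2 ⟨hx, hy, hxy⟩
      obtain ⟨j₀, hj₀⟩ := exists_nat_one_div_lt hδ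
      refine le_liminf_of_le (by isBoundedDefault) ?_
      filter_upwards [eventually_ge_atTop j₀] with j hj
      have hinj : Set.InjOn (q j) s := by
        intro x hx y hy hxy
        by_contra hne
        have h1 := hq j x y hxy
        have h2 := hsep x hx y hy hne
        have h3 : 1 / ((j : ℝ) + 1) ≤ 1 / ((j₀ : ℝ) + 1) := by gcongr
        linarith
      calc (s.card : ℝ≥0∞) = ∑ i ∈ s.image (q j), 1 := by
            rw [Finset.sum_const, Finset.card_image_of_injOn hinj]; simp
        _ ≤ ∑ i ∈ s.image (q j), (H j i).indicator (fun _ => 1) z := by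
            refine Finset.sum_le_sum fun i hi => ?_
            obtain ⟨x, hx, rfl⟩ := Finset.mem_image.1 hi
            rw [indicator_of_mem]
            exact subset_toMeasurable _ _ ⟨x, ⟨(hs hx).1, rfl⟩, (hs hx).2⟩
        _ ≤ h j z := ENNReal.sum_le_tsum _
    by_cases hfin : (E ∩ f ⁻¹' {z}).Finite
    · have := key hfin.toFinset (by simp)
      rwa [hfin.encard_eq_coe_toFinset_card, ENat.toENNReal_coe]
    · have htop : ∀ k : ℕ, (k : ℝ≥0∞) ≤ liminf (fun j => h j z) atTop := fun k => by
        obtain ⟨s, hs, hk⟩ := Set.Infinite.exists_subset_card_eq hfin k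
        exact hk ▸ key s hs
      have : liminf (fun j => h j z) atTop = ⊤ := ENNReal.eq_top_of_forall_nnreal_le fun r => by
        obtain ⟨k, hk⟩ := exists_nat_ge r
        refine le_trans ?_ (htop k)
        exact_mod_cast hk
      exact le_top.trans_eq this.symm
  · refine (lintegral_liminf_le hm).trans ?_
    refine liminf_le_of_le (by isBoundedDefault) fun b hb => ?_
    obtain ⟨j, hj⟩ := hb.exists
    refine hj.trans ?_
    rw [lintegral_tsum fun i => (measurable_const.indicator (hHm j i)).aemeasurable]
    calc ∑' i, ∫⁻ z, (H j i).indicator (fun _ => 1) z ∂μH[(n : ℝ)]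
        ≤ ∑' i, (c : ℝ≥0∞) ^ n * μH[(n : ℝ)] (E ∩ q j ⁻¹' {i}) := by
          refine ENNReal.tsum_le_tsum fun i => ?_
          rw [lintegral_indicator_const (hHm j i), one_mul, measure_toMeasurable]
          refine ((hf.mono inter_subset_left).hausdorffMeasure_image_le n.cast_nonneg).trans
            (le_of_eq ?_)
          rw [ENNReal.rpow_natCast]
      _ = (c : ℝ≥0∞) ^ n * μH[(n : ℝ)] E := by
          rw [ENNReal.tsum_mul_left, ← measure_iUnion]
          · rw [← inter_iUnion, ← preimage_iUnion, iUnion_of_singleton, preimage_univ, inter_univ]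
          · intro i i' hii
            exact Disjoint.mono inter_subset_right inter_subset_right
              (Disjoint.preimage _ (by simpa using hii))
          · exact fun i => hE.inter (hqm j (measurableSet_singleton i))

theorem PiecewiseDominated.lintegral_encard_le [SecondCountableTopology Y] {f : Y → Z}
    {ω : Measure Y} (h : PiecewiseDominated n f ω) (hf : Measurable f) {A : Set Z}
    (hA : MeasurableSet A) :
    ∫⁻ z in A, ((f ⁻¹' {z}).encard : ℝ≥0∞) ∂μH[(n : ℝ)] ≤ ω (f ⁻¹' A) := by
  obtain ⟨ι, hι, E, c, hE, hEc, hfE, hω⟩ := h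
  choose h hm hle hint using fun i => ((hfE i).mono inter_subset_left).exists_measurable_encard_le
    (n := n) ((hE i).inter (hf hA))
  have hpt : ∀ z ∈ A, ((f ⁻¹' {z}).encard : ℝ≥0∞) ≤ ∑' i, h i z := by
    classical
    intro z hz
    refine le_trans ?_ (ENNReal.tsum_le_tsum fun i => hle i z)
    have hcard : ∀ s : Finset Y, (s : Set Y) ⊆ f ⁻¹' {z} →
        (s.card : ℝ≥0∞) ≤ ∑' i, (((E i ∩ f ⁻¹' A) ∩ f ⁻¹' {z}).encard : ℝ≥0∞) := by
      intro s hs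
      choose i hi using fun y : Y => mem_iUnion.1 (hEc ▸ mem_univ y)
      refine le_trans ?_ (ENNReal.sum_le_tsum (s.image i))
      rw [Finset.card_eq_sum_card_image i s]
      push_cast
      refine Finset.sum_le_sum fun k _ => ?_
      have hsub : ((s.filter fun y => i y = k : Finset Y) : Set Y) ⊆
          (E k ∩ f ⁻¹' A) ∩ f ⁻¹' {z} := by
        intro y hy
        have hy' := Finset.mem_filter.1 (Finset.mem_coe.1 hy)
        have hz' : f y = z := hs hy'.1
        exact ⟨⟨hy'.2 ▸ hi y, by rw [mem_preimage, hz']; exact hz⟩, hz'⟩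
      have := Set.encard_le_encard hsub
      rw [Set.encard_coe_eq_coe_finsetCard] at this
      exact_mod_cast this
    by_cases hfin : (f ⁻¹' {z}).Finite
    · have := hcard hfin.toFinset (by simp)
      rwa [hfin.encard_eq_coe_toFinset_card, ENat.toENNReal_coe]
    · refine le_of_le_of_eq le_top (ENNReal.eq_top_of_forall_nnreal_le fun r => ?_).symm
      obtain ⟨k, hk⟩ := exists_nat_ge r
      obtain ⟨s, hs, hs'⟩ := Set.Infinite.exists_subset_card_eq hfin k
      refine le_trans ?_ (hs' ▸ hcard s hs)
      exact_mod_cast hk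
  calc ∫⁻ z in A, ((f ⁻¹' {z}).encard : ℝ≥0∞) ∂μH[(n : ℝ)]
      ≤ ∫⁻ z in A, ∑' i, h i z ∂μH[(n : ℝ)] := setLIntegral_mono (Measurable.tsum hm) hpt
    _ ≤ ∫⁻ z, ∑' i, h i z ∂μH[(n : ℝ)] := setLIntegral_le_lintegral _ _
    _ = ∑' i, ∫⁻ z, h i z ∂μH[(n : ℝ)] := lintegral_tsum fun i => (hm i).aemeasurable
    _ ≤ ∑' i, ((c i ^ n) • (μH[(n : ℝ)] : Measure Y).restrict (E i)) (f ⁻¹' A) := by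
        refine ENNReal.tsum_le_tsum fun i => (hint i).trans (le_of_eq ?_)
        rw [Measure.smul_apply, Measure.restrict_apply (hf hA), inter_comm, ENNReal.smul_def]
        simp
    _ ≤ ω (f ⁻¹' A) := by
        rw [← Measure.sum_apply _ (hf hA)]
        exact hω _

end PiecewiseDominated

/-- Given two measures, there is a point in a given set of positive volume, off a given null set,
around which the weighted sums of the measures of balls are controlled by the total masses. -/
theorem exists_forall_tsum_measure_closedBall_le {ι : Type*} [Fintype ι]
    (μ : Bool → Measure (ι → ℝ)) [∀ b, SFinite (μ b)] {Q B : Set (ι → ℝ)}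
    (hQm : MeasurableSet Q) (hQ0 : volume Q ≠ 0) (hQt : volume Q ≠ ⊤)
    (hB : volume B = 0)
    (d : ℕ → ℝ≥0∞) (r : ℕ → ℝ) (hr : ∀ l, 0 ≤ r l) {M : ℝ≥0∞}
    (hM : ∑' l, d l * ENNReal.ofReal ((2 * r l) ^ Fintype.card ι) ≤ M * volume Q) :
    ∃ a ∈ Q, a ∉ B ∧
      ∀ b, ∑' l, d l * μ b (closedBall a (r l)) ≤ 2 * (M * μ b Set.univ) := by
  have hmeas : ∀ l, MeasurableSet {p : (ι → ℝ) × (ι → ℝ) | dist p.2 p.1 ≤ r l} := fun l =>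
    (isClosed_le (by fun_prop) continuous_const).measurableSet
  have hball : ∀ b l, Measurable fun a => μ b (closedBall a (r l)) := fun b l =>
    measurable_measure_prodMk_left (hmeas l)
  let S : Bool → (ι → ℝ) → ℝ≥0∞ := fun b a => ∑' l, d l * μ b (closedBall a (r l))
  have hS : ∀ b, Measurable (S b) := fun b =>
    Measurable.tsum fun l => (hball b l).const_mul _
  have hint : ∀ b, ∫⁻ a in Q, S b a ≤ volume Q * (M * μ b Set.univ) := by
    intro b
    have hswap : ∀ l, ∫⁻ a in Q, μ b (closedBall a (r l)) ≤
        ENNReal.ofReal ((2 * r l) ^ Fintype.card ι) * μ b Set.univ := by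
      intro l
      have h1 : ∫⁻ a in Q, μ b (closedBall a (r l)) = ((volume.restrict Q).prod (μ b))
          {p : (ι → ℝ) × (ι → ℝ) | dist p.2 p.1 ≤ r l} := by
        rw [Measure.prod_apply (hmeas l)]
        rfl
      rw [h1, Measure.prod_apply_symm (hmeas l)]
      calc ∫⁻ y, (volume.restrict Q)
            ((fun x => (x, y)) ⁻¹' {p : (ι → ℝ) × (ι → ℝ) | dist p.2 p.1 ≤ r l}) ∂μ b
          ≤ ∫⁻ _, ENNReal.ofReal ((2 * r l) ^ Fintype.card ι) ∂μ b := by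
            refine lintegral_mono fun y => (Measure.restrict_apply_le _ _).trans ?_
            rw [← Real.volume_pi_closedBall y (hr l)]
            refine measure_mono fun x hx => ?_
            rw [mem_closedBall, dist_comm]
            exact hx
        _ = _ := lintegral_const _
    calc ∫⁻ a in Q, S b a = ∑' l, d l * ∫⁻ a in Q, μ b (closedBall a (r l)) := by
          rw [lintegral_tsum fun l => ((hball b l).const_mul _).aemeasurable]
          exact tsum_congr fun l => lintegral_const_mul _ (hball b l)
      _ ≤ ∑' l, d l * (ENNReal.ofReal ((2 * r l) ^ Fintype.card ι) * μ b Set.univ) :=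
          ENNReal.tsum_le_tsum fun l => mul_le_mul_right (hswap l) _
      _ = (∑' l, d l * ENNReal.ofReal ((2 * r l) ^ Fintype.card ι)) * μ b Set.univ := by
          rw [← ENNReal.tsum_mul_right]
          exact tsum_congr fun l => (mul_assoc _ _ _).symm
      _ ≤ M * volume Q * μ b Set.univ := mul_le_mul_left hM _
      _ = volume Q * (M * μ b Set.univ) := by ring
  have hne : volume.restrict Q ≠ 0 := by
    rwa [Ne, Measure.restrict_eq_zero]
  have hnull : (volume.restrict Q) (B ∪ Qᶜ) = 0 := by
    refine measure_union_null (le_antisymm ((Measure.restrict_apply_le _ _).trans hB.le) bot_le) ?_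
    rw [Measure.restrict_apply hQm.compl]
    simp
  have hdiv : ∀ b, Measurable fun a => S b a / (M * μ b Set.univ) := fun b => (hS b).div_const _
  have hfin : IsFiniteMeasure (volume.restrict Q) := isFiniteMeasure_restrict.2 hQt
  obtain ⟨a, ha, hle⟩ := exists_notMem_null_le_laverage hne
    (f := fun a => S true a / (M * μ true Set.univ) + S false a / (M * μ false Set.univ))
    ((hdiv true).add (hdiv false)).aemeasurable hnull
  have hone : ∀ b, ∫⁻ a in Q, S b a / (M * μ b Set.univ) ≤ volume Q := by
    intro b
    simp only [div_eq_mul_inv]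
    rw [lintegral_mul_const _ (hS b), ← div_eq_mul_inv]
    exact ENNReal.div_le_of_le_mul (hint b)
  have hav : S true a / (M * μ true Set.univ) + S false a / (M * μ false Set.univ) ≤ 2 := by
    refine hle.trans ?_
    rw [setLAverage_eq, lintegral_add_left (hdiv true)]
    refine ENNReal.div_le_of_le_mul ?_
    rw [two_mul]
    exact add_le_add (hone _) (hone _)
  simp only [mem_union, mem_compl_iff, not_or, not_not] at ha
  refine ⟨a, ha.2, ha.1, fun b => ?_⟩
  have : S b a / (M * μ b Set.univ) ≤ 2 := by
    cases b
    · exact le_add_self.trans hav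
    · exact le_self_add.trans hav
  exact (ENNReal.div_le_iff_le_mul (by simp) (by simp)).1 this
section Simplices

variable {I : Type*} [Fintype I]

/-- The barycentric support of a point: the set of its nonzero coordinates. -/
def vsupp (x : EuclideanSpace ℝ I) : Finset I := by
  classical exact Finset.univ.filter fun i => x i ≠ 0

/-- Points with nonnegative coordinates of sum `σ`. -/
def IsBary (σ : ℝ) (x : EuclideanSpace ℝ I) : Prop :=
  (∀ i, 0 ≤ x i) ∧ ∑ i, x i = σ

theorem mem_vsupp {x : EuclideanSpace ℝ I} {i : I} : i ∈ vsupp x ↔ x i ≠ 0 := by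
  simp [vsupp]

theorem vsupp_subset_iff {x : EuclideanSpace ℝ I} {S : Finset I} :
    vsupp x ⊆ S ↔ ∀ i ∉ S, x i = 0 := by
  refine forall_congr' fun i => ?_
  rw [mem_vsupp]
  tauto

theorem IsBary.vsupp_nonempty {σ : ℝ} {x : EuclideanSpace ℝ I} (hx : IsBary σ x) (hσ : 0 < σ) :
    (vsupp x).Nonempty := by
  by_contra h
  rw [Finset.not_nonempty_iff_eq_empty] at h
  have h0 : ∀ i, x i = 0 := fun i => vsupp_subset_iff.1 h.subset i (Finset.notMem_empty i)
  have := hx.2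
  simp only [h0, Finset.sum_const_zero] at this
  exact hσ.ne this

theorem IsBary.le {σ : ℝ} {x : EuclideanSpace ℝ I} (hx : IsBary σ x) (i : I) : x i ≤ σ :=
  hx.2 ▸ Finset.single_le_sum (f := fun i => x i) (fun j _ => hx.1 j) (Finset.mem_univ i)

theorem measurableSet_vsupp_eq (T : Finset I) :
    MeasurableSet {x : EuclideanSpace ℝ I | vsupp x = T} := by
  have : {x : EuclideanSpace ℝ I | vsupp x = T} = ⋂ i, {x | x i ≠ 0 ↔ i ∈ T} := by
    ext x
    simp [Finset.ext_iff, mem_vsupp]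
  rw [this]
  refine MeasurableSet.iInter fun i => ?_
  have h0 : MeasurableSet {x : EuclideanSpace ℝ I | x i ≠ 0} :=
    (isClosed_eq (by fun_prop) continuous_const).measurableSet.compl
  by_cases hi : i ∈ T
  · simpa [hi] using h0
  · simp only [hi, iff_false]
    exact h0.compl

theorem measurableSet_isBary (σ : ℝ) : MeasurableSet {x : EuclideanSpace ℝ I | IsBary σ x} := by
  simp only [IsBary, ofPred_and, ofPred_forall]
  refine MeasurableSet.inter (MeasurableSet.iInter fun i => ?_) ?_
  · exact (isClosed_le continuous_const (by fun_prop)).measurableSet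
  · exact (isClosed_eq (by fun_prop) continuous_const).measurableSet

section Realization

variable [DecidableEq I] {s : ℝ}

theorem sum_smul_vertex_apply (S : Finset I) (t : I → ℝ) (j : I) :
    (∑ i ∈ S, t i • vertex i : EuclideanSpace ℝ I) j = if j ∈ S then t j else 0 := by
  simp [vertex, Pi.single_apply]

theorem mem_simplexOf_iff (hs : 0 < s) {S : Finset I} {x : EuclideanSpace ℝ I} :
    x ∈ simplexOf s S ↔ IsBary (s / √2) x ∧ vsupp x ⊆ S := by
  have hσ : 0 < s / √2 := by positivity
  set σ := s / √2 with hσdef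
  rw [vsupp_subset_iff]
  constructor
  · rintro ⟨y, hy, rfl⟩
    have hsub : convexHull ℝ (vertex '' (S : Set I)) ⊆
        {y : EuclideanSpace ℝ I | (∀ i, 0 ≤ y i) ∧ ∑ i, y i = 1 ∧ ∀ i ∉ S, y i = 0} := by
      refine convexHull_min ?_ ?_
      · rintro _ ⟨i, hi, rfl⟩
        refine ⟨fun j => ?_, ?_, fun j hj => ?_⟩
        · simp only [vertex, PiLp.single_apply]
          split_ifs <;> simp
        · simp [vertex]
        · have : j ≠ i := fun h => hj (h ▸ hi)
          simp [vertex, this]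
      · rintro y ⟨h1, h2, h3⟩ z ⟨g1, g2, g3⟩ a b ha hb hab
        refine ⟨fun i => ?_, ?_, fun i hi => ?_⟩
        · have := mul_nonneg ha (h1 i)
          have := mul_nonneg hb (g1 i)
          simp only [PiLp.add_apply, PiLp.smul_apply, smul_eq_mul]
          positivity
        · simp only [PiLp.add_apply, PiLp.smul_apply, smul_eq_mul, Finset.sum_add_distrib,
            ← Finset.mul_sum, h2, g2]
          linarith
        · simp [h3 i hi, g3 i hi]
    obtain ⟨h1, h2, h3⟩ := hsub hy
    refine ⟨⟨fun i => ?_, ?_⟩, fun i hi => ?_⟩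
    · exact mul_nonneg hσ.le (h1 i)
    · simp only [PiLp.smul_apply, smul_eq_mul, ← Finset.mul_sum, h2, mul_one, ← hσdef]
    · simp [h3 i hi]
  · rintro ⟨⟨h1, h2⟩, h3⟩
    have hsum : ∑ i ∈ S, x i = σ := by
      rw [← h2]
      exact Finset.sum_subset (Finset.subset_univ S) fun i _ hi => h3 i hi
    refine ⟨∑ i ∈ S, (x i / σ) • vertex i, ?_, ?_⟩
    · refine (convex_convexHull ℝ _).sum_mem (fun i _ => div_nonneg (h1 i) hσ.le) ?_
        fun i hi => subset_convexHull ℝ _ ⟨i, hi, rfl⟩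
      rw [← Finset.sum_div, hsum, div_self hσ.ne']
    · ext j
      simp only [PiLp.smul_apply, smul_eq_mul, sum_smul_vertex_apply, ← hσdef]
      split_ifs with hj
      · field_simp
      · rw [h3 j hj, mul_zero]

theorem mem_openSimplexOf_iff (hs : 0 < s) {S : Finset I} {x : EuclideanSpace ℝ I} :
    x ∈ openSimplexOf s S ↔ IsBary (s / √2) x ∧ vsupp x = S := by
  have hσ : 0 < s / √2 := by positivity
  constructor
  · rintro ⟨t, h1, h2, rfl⟩
    have happ : ∀ j, ((s / √2) • ∑ i ∈ S, t i • vertex i : EuclideanSpace ℝ I) j =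
        s / √2 * if j ∈ S then t j else 0 := fun j => by
      simp only [PiLp.smul_apply, smul_eq_mul, sum_smul_vertex_apply]
    refine ⟨⟨fun i => ?_, ?_⟩, ?_⟩
    · rw [happ]
      split_ifs with hi
      · exact mul_nonneg hσ.le (h1 i hi).le
      · simp
    · simp only [happ, ← Finset.mul_sum, Finset.sum_ite_mem, Finset.univ_inter, h2, mul_one]
    · ext i
      rw [mem_vsupp, happ]
      by_cases hi : i ∈ S
      · simpa [hi, hs.ne'] using (h1 i hi).ne'
      · simp [hi]
  · rintro ⟨⟨h1, h2⟩, rfl⟩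
    refine ⟨fun i => x i / (s / √2), fun i hi => ?_, ?_, ?_⟩
    · exact div_pos ((h1 i).lt_of_ne' (mem_vsupp.1 hi)) hσ
    · rw [← Finset.sum_div, div_eq_one_iff_eq hσ.ne', ← h2]
      exact Finset.sum_subset (Finset.subset_univ _) fun i _ hi =>
        vsupp_subset_iff.1 subset_rfl i hi
    · ext j
      simp only [PiLp.smul_apply, smul_eq_mul, sum_smul_vertex_apply]
      split_ifs with hj
      · rw [mul_div_cancel₀ _ hσ.ne']
      · rw [vsupp_subset_iff.1 subset_rfl j hj, mul_zero]

theorem mem_skeleton_iff (hs : 0 < s) (K : SimplicialCplx I) {k : ℕ} {x : EuclideanSpace ℝ I} :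
    x ∈ skeleton s K k ↔ IsBary (s / √2) x ∧ vsupp x ∈ K.F ∧ (vsupp x).card ≤ k + 1 := by
  simp only [skeleton, mem_iUnion, mem_simplexOf_iff hs, exists_prop]
  constructor
  · rintro ⟨S, hS, hc, hx, hxS⟩
    exact ⟨hx, K.down_closed S hS _ hxS (hx.vsupp_nonempty (by positivity)),
      (Finset.card_le_card hxS).trans hc⟩
  · rintro ⟨hx, hF, hc⟩
    exact ⟨_, hF, hc, hx, subset_rfl⟩

theorem mem_realization_iff (hs : 0 < s) (K : SimplicialCplx I) {x : EuclideanSpace ℝ I} :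
    x ∈ realization s K ↔ IsBary (s / √2) x ∧ vsupp x ∈ K.F := by
  simp only [realization, mem_iUnion, mem_simplexOf_iff hs, exists_prop]
  constructor
  · rintro ⟨S, hS, hx, hxS⟩
    exact ⟨hx, K.down_closed S hS _ hxS (hx.vsupp_nonempty (by positivity))⟩
  · rintro ⟨hx, hF⟩
    exact ⟨_, hF, hx, subset_rfl⟩

theorem mem_openStar_iff (hs : 0 < s) (K : SimplicialCplx I) {T : Finset I}
    {x : EuclideanSpace ℝ I} :
    x ∈ openStar s K T ↔ IsBary (s / √2) x ∧ vsupp x ∈ K.F ∧ T ⊆ vsupp x := by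
  simp only [openStar, mem_iUnion, mem_openSimplexOf_iff hs, exists_prop]
  constructor
  · rintro ⟨S, hS, hT, hx, rfl⟩
    exact ⟨hx, hS, hT⟩
  · rintro ⟨hx, hF, hT⟩
    exact ⟨_, hF, hT, hx, rfl⟩

theorem measurableSet_openSimplexOf (hs : 0 < s) (S : Finset I) :
    MeasurableSet (openSimplexOf s S) := by
  have : openSimplexOf s S = {x | IsBary (s / √2) x} ∩ {x | vsupp x = S} := by
    ext x
    exact mem_openSimplexOf_iff hs
  rw [this]
  exact (measurableSet_isBary _).inter (measurableSet_vsupp_eq S)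

theorem measurableSet_openStar (hs : 0 < s) (K : SimplicialCplx I) (T : Finset I) :
    MeasurableSet (openStar s K T) :=
  K.F.measurableSet_biUnion fun S _ => MeasurableSet.iUnion fun _ =>
    measurableSet_openSimplexOf hs S

end Realization

/-- With respect to the center `a`, the Minkowski functional of `T - a`: it vanishes at the center
and equals `1` on the boundary of the simplex with vertex set `T`. -/
def radialGauge (a : EuclideanSpace ℝ I) (T : Finset I) (x : EuclideanSpace ℝ I) : ℝ :=
  1 - ⨅ i : T, x i / a i

/-- Radial projection from the center `a` to the boundary of the simplex with vertex set `T`. -/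
def radialProj (a : EuclideanSpace ℝ I) (T : Finset I) (x : EuclideanSpace ℝ I) :
    EuclideanSpace ℝ I :=
  a + (radialGauge a T x)⁻¹ • (x - a)

section Radial

variable {σ η : ℝ} {a x y : EuclideanSpace ℝ I} {T : Finset I}

theorem sub_le_radialGauge_mul (hpos : ∀ i ∈ T, 0 < a i) (x : EuclideanSpace ℝ I) {i : I}
    (hi : i ∈ T) : a i - x i ≤ radialGauge a T x * a i := by
  have h : (⨅ i : T, x i / a i) ≤ x i / a i :=
    ciInf_le (finite_range fun i : T => x i / a i).bddBelow (⟨i, hi⟩ : T)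
  rw [le_div_iff₀ (hpos i hi)] at h
  unfold radialGauge
  linarith

theorem exists_sub_eq_radialGauge_mul (hT : T.Nonempty) (hpos : ∀ i ∈ T, 0 < a i)
    (x : EuclideanSpace ℝ I) : ∃ i ∈ T, a i - x i = radialGauge a T x * a i := by
  have : Nonempty T := hT.to_subtype
  obtain ⟨⟨i, hi⟩, h⟩ := exists_eq_ciInf_of_finite (f := fun i : T => x i / a i)
  refine ⟨i, hi, ?_⟩
  unfold radialGauge
  rw [← h, sub_mul, div_mul_cancel₀ _ (hpos i hi).ne', one_mul]

theorem radialGauge_sub_le (hT : T.Nonempty) (hη : 0 < η) (ha : ∀ i ∈ T, η ≤ a i)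
    (x y : EuclideanSpace ℝ I) : radialGauge a T x - radialGauge a T y ≤ η⁻¹ * ‖x - y‖ := by
  have hpos : ∀ i ∈ T, 0 < a i := fun i hi => hη.trans_le (ha i hi)
  obtain ⟨i, hi, h⟩ := exists_sub_eq_radialGauge_mul hT hpos x
  have h' := sub_le_radialGauge_mul hpos y hi
  have hn : y i - x i ≤ ‖x - y‖ := by
    refine (le_abs_self _).trans ?_
    rw [abs_sub_comm]
    simpa using PiLp.norm_apply_le (x - y) i
  have hmul : (radialGauge a T x - radialGauge a T y) * a i ≤ ‖x - y‖ := by linarith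
  rw [inv_mul_eq_div, le_div_iff₀ hη]
  rcases le_total (radialGauge a T x - radialGauge a T y) 0 with h0 | h0
  · nlinarith [norm_nonneg (x - y)]
  · nlinarith [ha i hi]

theorem abs_radialGauge_sub_le (hT : T.Nonempty) (hη : 0 < η) (ha : ∀ i ∈ T, η ≤ a i)
    (x y : EuclideanSpace ℝ I) : |radialGauge a T x - radialGauge a T y| ≤ η⁻¹ * ‖x - y‖ := by
  rw [abs_sub_le_iff]
  exact ⟨radialGauge_sub_le hT hη ha x y, norm_sub_rev x y ▸ radialGauge_sub_le hT hη ha y x⟩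

theorem radialGauge_le_one (hT : T.Nonempty) (hpos : ∀ i ∈ T, 0 < a i) (hx : ∀ i, 0 ≤ x i) :
    radialGauge a T x ≤ 1 := by
  obtain ⟨i, hi, h⟩ := exists_sub_eq_radialGauge_mul hT hpos x
  nlinarith [hx i, hpos i hi]

theorem radialGauge_nonneg (hσ : 0 < σ) (ha : IsBary σ a) (haT : vsupp a = T) (hx : IsBary σ x)
    (hxT : vsupp x ⊆ T) : 0 ≤ radialGauge a T x := by
  have hpos : ∀ i ∈ T, 0 < a i := fun i hi =>
    (ha.1 i).lt_of_ne' (mem_vsupp.1 (haT ▸ hi))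
  have h : ∑ i, (a i - x i) ≤ ∑ i, radialGauge a T x * a i := by
    refine Finset.sum_le_sum fun i _ => ?_
    by_cases hi : i ∈ T
    · exact sub_le_radialGauge_mul hpos x hi
    · rw [vsupp_subset_iff.1 haT.subset i hi, vsupp_subset_iff.1 hxT i hi]
      simp
  rw [Finset.sum_sub_distrib, ha.2, hx.2, ← Finset.mul_sum, ha.2, sub_self] at h
  exact nonneg_of_mul_nonneg_left h hσ

theorem norm_sub_le_radialGauge (hσ : 0 < σ) (ha : IsBary σ a) (haT : vsupp a = T) (hx : IsBary σ x)
    (hxT : vsupp x ⊆ T) : ‖x - a‖ ≤ 2 * σ * radialGauge a T x := by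
  have hg := radialGauge_nonneg hσ ha haT hx hxT
  have hpos : ∀ i ∈ T, 0 < a i := fun i hi =>
    (ha.1 i).lt_of_ne' (mem_vsupp.1 (haT ▸ hi))
  have hl1 : ‖x - a‖ ≤ ∑ i, |x i - a i| := by
    rw [EuclideanSpace.norm_eq]
    refine Real.sqrt_le_iff.2 ⟨Finset.sum_nonneg fun i _ => abs_nonneg _, ?_⟩
    simp only [PiLp.sub_apply, Real.norm_eq_abs]
    exact Finset.sum_sq_le_sq_sum_of_nonneg fun i _ => abs_nonneg _
  refine hl1.trans ?_
  calc ∑ i, |x i - a i| ≤ ∑ i, ((x i - a i) + 2 * (radialGauge a T x * a i)) := by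
        refine Finset.sum_le_sum fun i _ => ?_
        have h0 : 0 ≤ radialGauge a T x * a i := mul_nonneg hg (ha.1 i)
        have h1 : a i - x i ≤ radialGauge a T x * a i := by
          by_cases hi : i ∈ T
          · exact sub_le_radialGauge_mul hpos x hi
          · rw [vsupp_subset_iff.1 haT.subset i hi, vsupp_subset_iff.1 hxT i hi]
            simp
        rw [abs_le]
        constructor <;> linarith
    _ = 2 * σ * radialGauge a T x := by
        rw [Finset.sum_add_distrib, Finset.sum_sub_distrib, ha.2, hx.2, ← Finset.mul_sum,
          ← Finset.mul_sum, ha.2]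
        ring

theorem radialGauge_pos (hσ : 0 < σ) (ha : IsBary σ a) (haT : vsupp a = T) (hx : IsBary σ x)
    (hxT : vsupp x ⊆ T) (hne : x ≠ a) : 0 < radialGauge a T x := by
  have h := norm_sub_le_radialGauge hσ ha haT hx hxT
  have h' : 0 < ‖x - a‖ := norm_pos_iff.2 (sub_ne_zero.2 hne)
  exact pos_of_mul_pos_right (h'.trans_le h) (by positivity)

theorem radialGauge_eq_one (hpos : ∀ i ∈ T, 0 < a i) (hx : ∀ i, 0 ≤ x i) (hxT : ¬ T ⊆ vsupp x) :
    radialGauge a T x = 1 := by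
  obtain ⟨i, hi, hxi⟩ := Finset.not_subset.1 hxT
  rw [mem_vsupp, not_not] at hxi
  refine le_antisymm (radialGauge_le_one ⟨i, hi⟩ hpos hx) ?_
  have := sub_le_radialGauge_mul hpos x hi
  rw [hxi] at this
  nlinarith [hpos i hi]

theorem radialProj_eq_self (hpos : ∀ i ∈ T, 0 < a i) (hx : ∀ i, 0 ≤ x i)
    (hxT : ¬ T ⊆ vsupp x) : radialProj a T x = x := by
  simp [radialProj, radialGauge_eq_one hpos hx hxT]

theorem IsBary.radialProj (hσ : 0 < σ) (ha : IsBary σ a) (haT : vsupp a = T) (hx : IsBary σ x)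
    (hxT : vsupp x ⊆ T) (hne : x ≠ a) :
    IsBary σ (radialProj a T x) ∧ vsupp (radialProj a T x) ⊂ T := by
  have hpos : ∀ i ∈ T, 0 < a i := fun i hi =>
    (ha.1 i).lt_of_ne' (mem_vsupp.1 (haT ▸ hi))
  have hg := radialGauge_pos hσ ha haT hx hxT hne
  have hT : T.Nonempty := haT ▸ ha.vsupp_nonempty hσ
  have happ : ∀ i, _root_.radialProj a T x i =
      (radialGauge a T x)⁻¹ * (radialGauge a T x * a i - (a i - x i)) := by
    intro i
    simp only [_root_.radialProj, PiLp.add_apply, PiLp.smul_apply, PiLp.sub_apply, smul_eq_mul]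
    field_simp
    ring
  have hoff : ∀ i ∉ T, _root_.radialProj a T x i = 0 := fun i hi => by
    rw [happ, vsupp_subset_iff.1 haT.subset i hi, vsupp_subset_iff.1 hxT i hi]
    simp
  refine ⟨⟨fun i => ?_, ?_⟩, ?_⟩
  · by_cases hi : i ∈ T
    · rw [happ]
      have := sub_le_radialGauge_mul hpos x hi
      exact mul_nonneg (inv_nonneg.2 hg.le) (by linarith)
    · rw [hoff i hi]
  · simp only [_root_.radialProj, PiLp.add_apply, PiLp.smul_apply, PiLp.sub_apply, smul_eq_mul,
      Finset.sum_add_distrib, ← Finset.mul_sum, Finset.sum_sub_distrib, ha.2, hx.2]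
    simp
  · obtain ⟨i, hi, h⟩ := exists_sub_eq_radialGauge_mul hT hpos x
    refine (Finset.ssubset_iff_of_subset (vsupp_subset_iff.2 hoff)).2 ⟨i, hi, ?_⟩
    rw [mem_vsupp, not_not, happ, h, sub_self, mul_zero]

theorem lipschitzOnWith_radialProj (hT : T.Nonempty) (hη : 0 < η) (ha : ∀ i ∈ T, η ≤ a i)
    {γ ρ : ℝ} (hγ : 0 < γ) (hρ : 0 ≤ ρ) {B : Set (EuclideanSpace ℝ I)}
    (hB : ∀ x ∈ B, γ ≤ radialGauge a T x ∧ ‖x - a‖ ≤ ρ * radialGauge a T x) :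
    LipschitzOnWith (Real.toNNReal ((1 + ρ * η⁻¹) * γ⁻¹)) (radialProj a T) B := by
  refine LipschitzOnWith.of_dist_le_mul fun x hx y hy => ?_
  rw [Real.coe_toNNReal _ (by positivity), dist_eq_norm, dist_eq_norm]
  obtain ⟨hx1, hx2⟩ := hB x hx
  obtain ⟨hy1, hy2⟩ := hB y hy
  set u := radialGauge a T x with hu
  set v := radialGauge a T y with hv
  have hu0 : 0 < u := hγ.trans_le hx1
  have hv0 : 0 < v := hγ.trans_le hy1
  have huv : |v - u| ≤ η⁻¹ * ‖x - y‖ := by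
    rw [abs_sub_comm]
    exact abs_radialGauge_sub_le hT hη ha x y
  have hdec : radialProj a T x - radialProj a T y =
      u⁻¹ • (x - y) + (u⁻¹ * v⁻¹ * (v - u)) • (y - a) := by
    simp only [radialProj, ← hu, ← hv]
    have : u⁻¹ * v⁻¹ * (v - u) = u⁻¹ - v⁻¹ := by field_simp
    rw [this]
    module
  have huγ : u⁻¹ ≤ γ⁻¹ := inv_anti₀ hγ hx1
  calc ‖radialProj a T x - radialProj a T y‖
      ≤ u⁻¹ * ‖x - y‖ + (u⁻¹ * v⁻¹ * |v - u|) * ‖y - a‖ := by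
        rw [hdec]
        refine (norm_add_le _ _).trans (le_of_eq ?_)
        rw [norm_smul, norm_smul, Real.norm_eq_abs, Real.norm_eq_abs, abs_mul, abs_mul,
          abs_of_pos (inv_pos.2 hu0), abs_of_pos (inv_pos.2 hv0)]
    _ ≤ u⁻¹ * ‖x - y‖ + (u⁻¹ * v⁻¹ * (η⁻¹ * ‖x - y‖)) * (ρ * v) := by gcongr
    _ = ((1 + ρ * η⁻¹) * u⁻¹) * ‖x - y‖ := by field_simp
    _ ≤ ((1 + ρ * η⁻¹) * γ⁻¹) * ‖x - y‖ := by gcongr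

end Radial

end Simplices
section Centers

/-- The Lipschitz constant of a radial projection on the `l`-th dyadic annulus. -/
def annulusConst (N l : ℕ) : ℝ≥0 := (4 * N + 5) * 2 ^ (l + 2)

/-- The averaged distortion of the radial projections of a simplex. -/
def centerConst (n N : ℕ) : ℝ≥0 := 2 * ((16 * N + 20) ^ n * (4 * (N + 1)) ^ N)

theorem tsum_annulusConst_le {σ : ℝ} (hσ : 0 < σ) {n N k : ℕ} (hk : n < k) (hkN : k ≤ N) :
    ∑' l, ((annulusConst N l : ℝ≥0∞) ^ n) * ENNReal.ofReal ((2 * (σ * (1 / 2) ^ l)) ^ k) ≤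
      centerConst n N * ENNReal.ofReal ((σ / (2 * (k + 1))) ^ k) := by
  have hterm : ∀ l : ℕ, ((annulusConst N l : ℝ≥0∞) ^ n) *
      ENNReal.ofReal ((2 * (σ * (1 / 2) ^ l)) ^ k) ≤
      ENNReal.ofReal ((16 * N + 20) ^ n * (4 * (N + 1)) ^ N * (σ / (2 * (k + 1))) ^ k) *
        (2⁻¹ : ℝ≥0∞) ^ l := by
    intro l
    have h2 : (2⁻¹ : ℝ≥0∞) ^ l = ENNReal.ofReal ((1 / 2) ^ l) := by
      rw [ENNReal.ofReal_pow (by norm_num), one_div, ENNReal.ofReal_inv_of_pos (by norm_num)]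
      simp
    have h3 : ((annulusConst N l : ℝ≥0∞) ^ n) =
        ENNReal.ofReal (((16 * N + 20) * 2 ^ l) ^ n) := by
      rw [ENNReal.ofReal_pow (by positivity), ENNReal.ofReal, ]
      congr 2
      rw [← NNReal.coe_inj, Real.coe_toNNReal _ (by positivity)]
      simp only [annulusConst]
      push_cast
      ring
    rw [h2, h3, ← ENNReal.ofReal_mul (by positivity), ← ENNReal.ofReal_mul (by positivity)]
    refine ENNReal.ofReal_le_ofReal ?_
    have h4 : ((2 : ℝ) ^ l) ^ n * ((1 / 2) ^ l) ^ k ≤ (1 / 2) ^ l := by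
      obtain ⟨j, rfl⟩ : ∃ j, k = n + 1 + j := ⟨k - (n + 1), by omega⟩
      calc ((2 : ℝ) ^ l) ^ n * ((1 / 2) ^ l) ^ (n + 1 + j)
          = ((2 : ℝ) ^ l * (1 / 2) ^ l) ^ n * (1 / 2) ^ l * ((1 / 2) ^ l) ^ j := by ring
        _ = (1 / 2) ^ l * ((1 / 2) ^ l) ^ j := by rw [← mul_pow]; norm_num
        _ ≤ (1 / 2) ^ l * 1 := by
            gcongr
            exact pow_le_one₀ (by positivity) (pow_le_one₀ (by norm_num) (by norm_num))
        _ = _ := mul_one _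
    have h5 : (4 * ((k : ℝ) + 1)) ^ k ≤ (4 * (N + 1)) ^ N := by
      have : (k : ℝ) ≤ N := by exact_mod_cast hkN
      calc (4 * ((k : ℝ) + 1)) ^ k ≤ (4 * (N + 1)) ^ k := by gcongr
        _ ≤ _ := pow_le_pow_right₀ (by have := N.cast_nonneg (α := ℝ); linarith) hkN
    have h6 : 2 * σ = 4 * (k + 1) * (σ / (2 * (k + 1))) := by field_simp; ring
    calc ((16 * (N : ℝ) + 20) * 2 ^ l) ^ n * (2 * (σ * (1 / 2) ^ l)) ^ k
        = (16 * N + 20) ^ n * (2 * σ) ^ k * ((2 ^ l) ^ n * ((1 / 2) ^ l) ^ k) := by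
          rw [mul_pow (16 * (N : ℝ) + 20), ← mul_assoc 2 σ, mul_pow (2 * σ)]
          ring
      _ = (16 * N + 20) ^ n * (4 * (k + 1)) ^ k * (σ / (2 * (k + 1))) ^ k *
            ((2 ^ l) ^ n * ((1 / 2) ^ l) ^ k) := by rw [h6, mul_pow]; ring
      _ ≤ _ := by gcongr
  refine (ENNReal.tsum_le_tsum hterm).trans (le_of_eq ?_)
  rw [ENNReal.tsum_mul_left, ENNReal.tsum_geometric_two, ENNReal.ofReal_mul (by positivity)]
  have : (centerConst n N : ℝ≥0∞) =
      ENNReal.ofReal ((16 * N + 20) ^ n * (4 * (N + 1)) ^ N) * 2 := by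
    rw [mul_comm, ← ENNReal.ofReal_ofNat, ← ENNReal.ofReal_mul (by positivity), ENNReal.ofReal]
    congr 1
    rw [← NNReal.coe_inj, Real.coe_toNNReal _ (by positivity)]
    simp only [centerConst]
    push_cast
    ring
  rw [this]
  ring

variable {I : Type*} [DecidableEq I] {σ : ℝ}

/-- The point with prescribed coordinates on `T.erase i₀`, vanishing off `T`, of coordinate
sum `σ`. -/
def centerOf (σ : ℝ) (T : Finset I) (i₀ : I) (a : T.erase i₀ → ℝ) : EuclideanSpace ℝ I :=
  WithLp.toLp 2 fun i => (if h : i ∈ T.erase i₀ then a ⟨i, h⟩ else 0) +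
    if i = i₀ then σ - ∑ j, a j else 0

theorem centerOf_apply_of_mem {T : Finset I} {i₀ : I} (a : T.erase i₀ → ℝ) (i : T.erase i₀) :
    centerOf σ T i₀ a i = a i := by
  have h := Finset.mem_erase.1 i.2
  simp [centerOf, h.1, h.2]

theorem centerOf_apply_self {T : Finset I} {i₀ : I} (a : T.erase i₀ → ℝ) :
    centerOf σ T i₀ a i₀ = σ - ∑ j, a j := by
  simp [centerOf]

theorem centerOf_apply_of_notMem {T : Finset I} {i₀ : I} (h₀ : i₀ ∈ T) (a : T.erase i₀ → ℝ)
    {i : I} (hi : i ∉ T) : centerOf σ T i₀ a i = 0 := by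
  have : i ≠ i₀ := fun h => hi (h ▸ h₀)
  simp [centerOf, hi, this]

variable [Fintype I]

theorem sum_centerOf {T : Finset I} {i₀ : I} (a : T.erase i₀ → ℝ) :
    ∑ i, centerOf σ T i₀ a i = σ := by
  simp only [centerOf, Finset.sum_add_distrib, Finset.sum_ite_eq', Finset.mem_univ, if_true]
  have h : ∑ j, a j = ∑ i ∈ T.erase i₀, if h : i ∈ T.erase i₀ then a ⟨i, h⟩ else 0 := by
    rw [← Finset.sum_coe_sort (T.erase i₀) fun i => if h : i ∈ T.erase i₀ then a ⟨i, h⟩ else 0]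
    exact Finset.sum_congr rfl fun j _ => by rw [dif_pos j.2]
  rw [h, Finset.sum_subset (Finset.subset_univ _) fun i _ hi => dif_neg hi, add_sub_cancel]

theorem exists_center (hσ : 0 < σ) {n N k : ℕ} (hk : n < k) (hkN : k ≤ N) {T : Finset I}
    (hT : T.card = k + 1) (μ : Bool → Measure (EuclideanSpace ℝ I)) [∀ b, SFinite (μ b)]
    {Z : Set (EuclideanSpace ℝ I)} (hZ : μH[(k : ℝ)] Z = 0) :
    ∃ a, IsBary σ a ∧ vsupp a = T ∧ (∀ i ∈ T, σ / (2 * (N + 1)) ≤ a i) ∧ a ∉ Z ∧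
      ∃ A : ℕ → Set (EuclideanSpace ℝ I), (∀ l, MeasurableSet (A l)) ∧
        (∀ x, IsBary σ x → vsupp x = T → x ≠ a → ∃ l, x ∈ A l) ∧
        (∀ l, LipschitzOnWith (annulusConst N l) (radialProj a T)
          (A l ∩ {x | IsBary σ x ∧ vsupp x = T})) ∧
        ∀ b, ∑' l, (annulusConst N l : ℝ≥0∞) ^ n * μ b (A l) ≤
          2 * (centerConst n N * μ b Set.univ) := by
  obtain ⟨i₀, hi₀⟩ : T.Nonempty := Finset.card_pos.1 (by omega)
  have hcard : Fintype.card (T.erase i₀) = k := by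
    rw [Fintype.card_coe, Finset.card_erase_of_mem hi₀, hT, Nat.add_sub_cancel]
  let proj : EuclideanSpace ℝ I → (T.erase i₀ → ℝ) := fun x i => x i
  have hproj : LipschitzWith 1 proj := LipschitzWith.of_dist_le_mul fun x y => by
    rw [NNReal.coe_one, one_mul, dist_pi_le_iff dist_nonneg]
    intro i
    rw [dist_eq_norm, dist_eq_norm]
    exact PiLp.norm_apply_le (x - y) i
  have hprojm : Measurable proj := hproj.continuous.measurable
  let Q : Set (T.erase i₀ → ℝ) :=
    Set.Icc (fun _ => σ / (2 * (k + 1))) (fun _ => σ / (k + 1))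
  have hvol : volume Q = ENNReal.ofReal ((σ / (2 * (k + 1))) ^ k) := by
    rw [Real.volume_Icc_pi]
    simp only [Finset.prod_const, Finset.card_univ, hcard]
    rw [← ENNReal.ofReal_pow]
    · congr 2
      field_simp
      ring
    · rw [sub_nonneg]
      gcongr
      have := k.cast_nonneg (α := ℝ)
      linarith
  have hproj_cen : ∀ a, proj (centerOf σ T i₀ a) = a := fun a =>
    funext fun i => centerOf_apply_of_mem a i
  have hB : volume {a | centerOf σ T i₀ a ∈ Z} = 0 := by
    refine measure_mono_null (t := proj '' Z) (fun a ha => ⟨_, ha, hproj_cen a⟩) ?_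
    rw [← hausdorffMeasure_pi_real, hcard]
    have := hproj.hausdorffMeasure_image_le k.cast_nonneg Z
    rw [hZ, mul_zero] at this
    exact le_antisymm this bot_le
  have hM : ∑' l, ((annulusConst N l : ℝ≥0∞) ^ n) *
      ENNReal.ofReal ((2 * (σ * (1 / 2) ^ l)) ^ Fintype.card (T.erase i₀)) ≤
      centerConst n N * volume Q := by
    rw [hvol, hcard]
    exact tsum_annulusConst_le hσ hk hkN
  obtain ⟨a', haQ, haB, hsum⟩ := exists_forall_tsum_measure_closedBall_le
    (fun b => (μ b).map proj) (Q := Q) measurableSet_Icc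
    (by rw [hvol]; simp only [ne_eq, ENNReal.ofReal_eq_zero, not_le]; positivity)
    (by rw [hvol]; exact ENNReal.ofReal_ne_top) hB _ _ (fun l => by positivity) hM
  have hη : ∀ i ∈ T, σ / (2 * (k + 1)) ≤ centerOf σ T i₀ a' i := by
    intro i hi
    by_cases h : i = i₀
    · subst h
      rw [centerOf_apply_self]
      have h1 : ∑ j, a' j ≤ ∑ _j : T.erase i, σ / (k + 1) :=
        Finset.sum_le_sum fun j _ => haQ.2 j
      rw [Finset.sum_const, Finset.card_univ, hcard, nsmul_eq_mul] at h1
      have h2 : σ - k * (σ / (k + 1)) = σ / (k + 1) := by field_simp; ring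
      have h3 : σ / (2 * (k + 1)) ≤ σ / (k + 1) := by
        gcongr
        have := k.cast_nonneg (α := ℝ)
        linarith
      linarith
    · rw [centerOf_apply_of_mem a' ⟨i, Finset.mem_erase.2 ⟨h, hi⟩⟩]
      exact haQ.1 _
  have hk0 : 0 < σ / (2 * ((k : ℝ) + 1)) := by positivity
  set a := centerOf σ T i₀ a' with ha
  have hoff : ∀ i ∉ T, a i = 0 := fun i hi => centerOf_apply_of_notMem hi₀ a' hi
  have hbary : IsBary σ a := by
    refine ⟨fun i => ?_, sum_centerOf a'⟩
    by_cases hi : i ∈ T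
    · exact hk0.le.trans (hη i hi)
    · exact (hoff i hi).ge
  have hvs : vsupp a = T := by
    refine (vsupp_subset_iff.2 hoff).antisymm fun i hi => mem_vsupp.2 ?_
    exact (hk0.trans_le (hη i hi)).ne'
  have hηN : ∀ i ∈ T, σ / (2 * (N + 1)) ≤ a i := fun i hi => by
    refine le_trans ?_ (hη i hi)
    gcongr
  have hdist : Continuous fun x => dist (proj x) a' := hproj.continuous.dist continuous_const
  refine ⟨a, hbary, hvs, hηN, haB, fun l => {x | dist (proj x) a' ≤ σ * (1 / 2) ^ l ∧
    σ * (1 / 2) ^ (l + 1) ≤ dist (proj x) a'}, fun l => ?_, fun x hx hxT hne => ?_, fun l => ?_,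
    fun b => ?_⟩
  · exact ((isClosed_le hdist continuous_const).inter
      (isClosed_le continuous_const hdist)).measurableSet
  · have hpos : 0 < dist (proj x) a' := by
      rw [dist_pos]
      intro h
      apply hne
      have hi : ∀ i, i ≠ i₀ → x i = a i := by
        intro i hi
        by_cases hiT : i ∈ T
        · have := congrFun (h.trans (hproj_cen a').symm) ⟨i, Finset.mem_erase.2 ⟨hi, hiT⟩⟩
          exact this
        · rw [hoff i hiT, vsupp_subset_iff.1 hxT.subset i hiT]
      ext i
      by_cases hi' : i = i₀
      · subst hi'
        have h1 := hx.2.trans hbary.2.symm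
        rw [← Finset.add_sum_erase _ _ (Finset.mem_univ i),
          ← Finset.add_sum_erase _ (fun i => a i) (Finset.mem_univ i),
          Finset.sum_congr rfl fun j hj => hi j (Finset.ne_of_mem_erase hj)] at h1
        exact add_right_cancel h1
      · exact hi i hi'
    have hle : dist (proj x) a' ≤ σ := by
      rw [dist_pi_le_iff hσ.le]
      intro i
      have h1 := hbary.le i
      have h2 := hbary.1 i
      rw [ha, centerOf_apply_of_mem] at h1 h2
      rw [Real.dist_eq, abs_le]
      have h3 := hx.le i
      have h4 := hx.1 i
      constructor <;> simp only [proj] <;> linarith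
    obtain ⟨l, hl1, hl2⟩ := exists_nat_pow_near_of_lt_one (x := dist (proj x) a' / σ)
      (y := 1 / 2) (by positivity) ((div_le_one hσ).2 hle) (by norm_num) (by norm_num)
    refine ⟨l, ?_, ?_⟩
    · rwa [div_le_iff₀ hσ, mul_comm] at hl2
    · rw [lt_div_iff₀ hσ, mul_comm] at hl1
      exact hl1.le
  · have hN0 : 0 < σ / (2 * ((N : ℝ) + 1)) := by positivity
    have hlip := lipschitzOnWith_radialProj (a := a) ⟨i₀, hi₀⟩ hN0 hηN
      (γ := (1 / 2) ^ (l + 2)) (ρ := 2 * σ) (by positivity) (by positivity)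
      (B := {x | dist (proj x) a' ≤ σ * (1 / 2) ^ l ∧
        σ * (1 / 2) ^ (l + 1) ≤ dist (proj x) a'} ∩ {x | IsBary σ x ∧ vsupp x = T}) ?_
    · convert hlip using 1
      rw [← NNReal.coe_inj, Real.coe_toNNReal _ (by positivity)]
      simp only [annulusConst]
      push_cast
      rw [← inv_pow]
      field_simp
      ring
    · rintro x ⟨⟨-, hx⟩, hxb, hxT⟩
      have h1 := norm_sub_le_radialGauge hσ hbary hvs hxb hxT.subset
      have h2 : dist (proj x) a' ≤ ‖x - a‖ := by
        have := hproj.dist_le_mul x a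
        rwa [hproj_cen, NNReal.coe_one, one_mul, dist_eq_norm x a] at this
      refine ⟨?_, h1⟩
      have h3 := (hx.trans h2).trans h1
      rw [pow_succ] at h3
      rw [pow_succ, pow_succ]
      nlinarith
  · refine le_trans (ENNReal.tsum_le_tsum fun l => mul_le_mul_right ?_ _) ((hsum b).trans_eq ?_)
    · rw [Measure.map_apply hprojm measurableSet_closedBall]
      exact measure_mono fun x hx => hx.1
    · rw [Measure.map_apply hprojm MeasurableSet.univ, preimage_univ]

end Centers
section SkeletonStep

theorem exists_lipschitzOnWith_radialProj {I : Type*} [Fintype I] {σ η : ℝ} (hσ : 0 < σ)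
    {a : EuclideanSpace ℝ I} {T : Finset I} (ha : IsBary σ a) (haT : vsupp a = T) (hη : 0 < η)
    (haη : ∀ i ∈ T, η ≤ a i) {Z : Set (EuclideanSpace ℝ I)} (hZ : IsCompact Z) (haZ : a ∉ Z)
    (hZT : ∀ x ∈ Z, IsBary σ x ∧ (T ⊆ vsupp x → vsupp x = T)) :
    ∃ c : ℝ≥0, LipschitzOnWith c (radialProj a T) Z := by
  have hT : T.Nonempty := haT ▸ ha.vsupp_nonempty hσ
  have hpos : ∀ i ∈ T, 0 < a i := fun i hi => hη.trans_le (haη i hi)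
  have hgpos : ∀ x ∈ Z, 0 < radialGauge a T x := by
    intro x hx
    obtain ⟨hb, hs⟩ := hZT x hx
    by_cases h : T ⊆ vsupp x
    · exact radialGauge_pos hσ ha haT hb (hs h).subset (ne_of_mem_of_not_mem hx haZ)
    · rw [radialGauge_eq_one hpos hb.1 h]
      exact one_pos
  have hcont : Continuous (radialGauge a T) := by
    refine (LipschitzWith.of_dist_le_mul (K := (η⁻¹).toNNReal) fun x y => ?_).continuous
    rw [Real.coe_toNNReal _ (by positivity), Real.dist_eq, dist_eq_norm]
    exact abs_radialGauge_sub_le hT hη haη x y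
  obtain ⟨γ, hγ, hγZ⟩ := hZ.exists_forall_le' hcont.continuousOn hgpos
  obtain ⟨R, hR⟩ := hZ.isBounded.exists_norm_le
  refine ⟨_, lipschitzOnWith_radialProj hT hη haη hγ
    (ρ := (|R| + ‖a‖) / γ) (by positivity) fun x hx => ⟨hγZ x hx, ?_⟩⟩
  calc ‖x - a‖ ≤ ‖x‖ + ‖a‖ := norm_sub_le x a
    _ ≤ |R| + ‖a‖ := by gcongr; exact (hR x hx).trans (le_abs_self R)
    _ = (|R| + ‖a‖) / γ * γ := by field_simp
    _ ≤ _ := by gcongr; exact hγZ x hx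

theorem exists_lipschitzOnWith_sum {E ι : Type*} [NormedAddCommGroup E] (t : Finset ι)
    {f : ι → E → E} {Z : Set E} (hf : ∀ i ∈ t, ∃ c : ℝ≥0, LipschitzOnWith c (f i) Z) :
    ∃ c : ℝ≥0, LipschitzOnWith c (fun x => x + ∑ i ∈ t, (f i x - x)) Z := by
  classical
  induction t using Finset.induction_on with
  | empty => exact ⟨1, fun x _ y _ => by simp⟩
  | insert j t hj ih =>
    obtain ⟨c, hc⟩ := ih fun i hi => hf i (Finset.mem_insert_of_mem hi)
    obtain ⟨c', hc'⟩ := hf j (Finset.mem_insert_self j t)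
    refine ⟨c + (c' + 1), LipschitzOnWith.of_dist_le_mul fun x hx y hy => ?_⟩
    have h1 := hc.dist_le_mul x hx y hy
    have h2 := hc'.dist_le_mul x hx y hy
    rw [dist_eq_norm] at h1 h2 ⊢
    rw [Finset.sum_insert hj, Finset.sum_insert hj]
    set u := ∑ i ∈ t, (f i x - x)
    set v := ∑ i ∈ t, (f i y - y)
    calc ‖x + (f j x - x + u) - (y + (f j y - y + v))‖
        = ‖(x + u - (y + v)) + ((f j x - f j y) - (x - y))‖ := by congr 1; abel
      _ ≤ ‖x + u - (y + v)‖ + (‖f j x - f j y‖ + ‖x - y‖) :=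
        (norm_add_le _ _).trans (by gcongr; exact norm_sub_le _ _)
      _ ≤ c * dist x y + (c' * dist x y + dist x y) := by
        gcongr
        exact (dist_eq_norm x y).ge
      _ = _ := by push_cast; ring

variable {I : Type} [Fintype I]

/-- The map pushing each `k`-dimensional open simplex radially to its boundary, away from
the center `a T` of the simplex with vertex set `T`, and fixing all other points. -/
def radialStep (k : ℕ) (a : Finset I → EuclideanSpace ℝ I) (x : EuclideanSpace ℝ I) :
    EuclideanSpace ℝ I :=
  if (vsupp x).card = k + 1 then radialProj (a (vsupp x)) (vsupp x) x else x

theorem isBary_radialStep {σ : ℝ} (hσ : 0 < σ) {k : ℕ} {a : Finset I → EuclideanSpace ℝ I}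
    (ha : ∀ T : Finset I, T.card = k + 1 → IsBary σ (a T) ∧ vsupp (a T) = T)
    {x : EuclideanSpace ℝ I} (hx : IsBary σ x) :
    IsBary σ (radialStep k a x) ∧ vsupp (radialStep k a x) ⊆ vsupp x ∧
      ((vsupp x).card = k + 1 → x ≠ a (vsupp x) → vsupp (radialStep k a x) ⊂ vsupp x) := by
  by_cases hc : (vsupp x).card = k + 1
  · obtain ⟨hb, hv⟩ := ha _ hc
    simp only [radialStep, hc, if_true]
    by_cases hne : x = a (vsupp x)
    · have : radialProj (a (vsupp x)) (vsupp x) x = x := by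
        unfold radialProj
        rw [← hne]
        simp
      rw [this]
      exact ⟨hx, subset_rfl, fun _ h => absurd hne h⟩
    · have h := IsBary.radialProj hσ hb hv hx subset_rfl hne
      exact ⟨h.1, h.2.subset, fun _ _ => h.2⟩
  · simp only [radialStep, hc, if_false]
    exact ⟨hx, subset_rfl, fun h => h.elim⟩

theorem exists_lipschitzOnWith_radialStep {σ η : ℝ} (hσ : 0 < σ) (hη : 0 < η) {k : ℕ}
    {a : Finset I → EuclideanSpace ℝ I} {Z : Set (EuclideanSpace ℝ I)} (hZ : IsCompact Z)
    (hZk : ∀ x ∈ Z, IsBary σ x ∧ (vsupp x).card ≤ k + 1)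
    (ha : ∀ T : Finset I, T.card = k + 1 →
      IsBary σ (a T) ∧ vsupp (a T) = T ∧ (∀ i ∈ T, η ≤ a T i) ∧ a T ∉ Z) :
    ∃ c : ℝ≥0, LipschitzOnWith c (radialStep k a) Z := by
  set t : Finset (Finset I) := Finset.univ.filter fun T => T.card = k + 1
  have hsub : ∀ x ∈ Z, ∀ T : Finset I, T.card = k + 1 → T ⊆ vsupp x → vsupp x = T :=
    fun x hx T hT h => (Finset.eq_of_subset_of_card_le h (hT ▸ (hZk x hx).2)).symm
  obtain ⟨c, hc⟩ := exists_lipschitzOnWith_sum t (f := fun T => radialProj (a T) T) (Z := Z)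
    fun T hT => by
      have hT' : T.card = k + 1 := (Finset.mem_filter.1 hT).2
      obtain ⟨h1, h2, h3, h4⟩ := ha T hT'
      exact exists_lipschitzOnWith_radialProj hσ h1 h2 hη h3 hZ h4 fun x hx =>
        ⟨(hZk x hx).1, hsub x hx T hT'⟩
  refine ⟨c, fun x hx y hy => ?_⟩
  have key : ∀ x ∈ Z, radialStep k a x = x + ∑ T ∈ t, (radialProj (a T) T x - x) := by
    intro x hx
    have hzero : ∀ T ∈ t, T ≠ vsupp x → radialProj (a T) T x - x = 0 := by
      intro T hT hne
      have hT' : T.card = k + 1 := (Finset.mem_filter.1 hT).2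
      rw [radialProj_eq_self (fun i hi => hη.trans_le ((ha T hT').2.2.1 i hi)) (hZk x hx).1.1
        fun h => hne (hsub x hx T hT' h).symm, sub_self]
    by_cases hcard : (vsupp x).card = k + 1
    · rw [Finset.sum_eq_single_of_mem (vsupp x) (Finset.mem_filter.2 ⟨Finset.mem_univ _, hcard⟩)
        hzero]
      simp [radialStep, hcard]
    · rw [Finset.sum_eq_zero fun T hT => hzero T hT fun h =>
        hcard (h ▸ (Finset.mem_filter.1 hT).2)]
      simp [radialStep, hcard]
  rw [key x hx, key y hy]
  exact hc hx hy

theorem exists_skeleton_step [DecidableEq I] {s : ℝ} (hs : 0 < s) (K : SimplicialCplx I)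
    {n N k : ℕ} (hk : n < k) (hkN : k ≤ N) {Z : Set (EuclideanSpace ℝ I)} (hZ : IsCompact Z)
    (hZK : Z ⊆ skeleton s K k) (hZ0 : μH[(k : ℝ)] Z = 0)
    (μ : Bool → Measure (EuclideanSpace ℝ I)) [∀ b, SFinite (μ b)] :
    ∃ q : EuclideanSpace ℝ I → EuclideanSpace ℝ I,
      (∀ S ∈ K.F, ∀ x ∈ simplexOf s S, q x ∈ simplexOf s S) ∧
      (∃ c : ℝ≥0, LipschitzOnWith c q Z) ∧ (∀ x ∈ Z, q x ∈ skeleton s K (k - 1)) ∧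
      ∃ (κ : Type) (_ : Countable κ) (A : κ → Set (EuclideanSpace ℝ I)) (d : κ → ℝ≥0),
        (∀ l, MeasurableSet (A l)) ∧ (∀ x ∈ Z, ∃ l, x ∈ A l) ∧
        (∀ l, LipschitzOnWith (d l) q (A l)) ∧
        ∀ b T, ∑' l, (d l : ℝ≥0∞) ^ n * μ b (A l ∩ openStar s K T) ≤
          (1 + 2 * centerConst n N : ℝ≥0) * μ b (openStar s K T) := by
  set σ := s / √2 with hσdef
  have hσ : 0 < σ := by positivity
  have hcenter : ∀ T : Finset I, T.card = k + 1 → ∃ a, IsBary σ a ∧ vsupp a = T ∧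
      (∀ i ∈ T, σ / (2 * (N + 1)) ≤ a i) ∧ a ∉ Z ∧
      ∃ A : ℕ → Set (EuclideanSpace ℝ I), (∀ l, MeasurableSet (A l)) ∧
        (∀ x, IsBary σ x → vsupp x = T → x ≠ a → ∃ l, x ∈ A l) ∧
        (∀ l, LipschitzOnWith (annulusConst N l) (radialProj a T)
          (A l ∩ {x | IsBary σ x ∧ vsupp x = T})) ∧
        ∀ b, ∑' l, (annulusConst N l : ℝ≥0∞) ^ n * (μ b).restrict (openSimplexOf s T) (A l) ≤
          2 * (centerConst n N * (μ b).restrict (openSimplexOf s T) univ) := fun T hT =>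
    exists_center hσ hk hkN hT (fun b => (μ b).restrict (openSimplexOf s T)) hZ0
  choose! a hab hav haη haZ hA using hcenter
  have hZb : ∀ x ∈ Z, IsBary σ x ∧ (vsupp x).card ≤ k + 1 := fun x hx =>
    have := (mem_skeleton_iff hs K).1 (hZK hx)
    ⟨this.1, this.2.2⟩
  have hstep : ∀ {x}, IsBary σ x → _ := fun {x} hx =>
    isBary_radialStep (x := x) hσ (fun T hT => ⟨hab T hT, hav T hT⟩) hx
  have hpiece : ∀ T : Finset I, ∃ (A : ℕ → Set (EuclideanSpace ℝ I)) (d : ℕ → ℝ≥0),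
      (∀ l, MeasurableSet (A l)) ∧ (∀ l, A l ⊆ openSimplexOf s T) ∧
      (∀ x ∈ Z, x ∈ openSimplexOf s T → ∃ l, x ∈ A l) ∧
      (∀ l, LipschitzOnWith (d l) (radialStep k a) (A l)) ∧
      ∀ b, ∑' l, (d l : ℝ≥0∞) ^ n * μ b (A l) ≤
        (1 + 2 * centerConst n N : ℝ≥0) * μ b (openSimplexOf s T) := by
    intro T
    by_cases hT : T.card = k + 1
    · obtain ⟨A, hAm, hAc, hAl, hAs⟩ := hA T hT
      refine ⟨fun l => A l ∩ openSimplexOf s T, annulusConst N,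
        fun l => (hAm l).inter (measurableSet_openSimplexOf hs T), fun l => inter_subset_right,
        fun x hx hxT => ?_, fun l => ?_, fun b => ?_⟩
      · obtain ⟨h1, h2⟩ := (mem_openSimplexOf_iff hs).1 hxT
        obtain ⟨l, hl⟩ := hAc x h1 h2 (ne_of_mem_of_not_mem hx (haZ T hT))
        exact ⟨l, hl, hxT⟩
      · have heq : ∀ x ∈ openSimplexOf s T, radialStep k a x = radialProj (a T) T x := by
          intro x hx
          obtain ⟨-, rfl⟩ := (mem_openSimplexOf_iff hs).1 hx
          simp [radialStep, hT]
        intro x hx y hy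
        rw [heq x hx.2, heq y hy.2]
        exact hAl l ⟨hx.1, (mem_openSimplexOf_iff hs).1 hx.2⟩
          ⟨hy.1, (mem_openSimplexOf_iff hs).1 hy.2⟩
      · have h := hAs b
        simp only [Measure.restrict_apply (hAm _), Measure.restrict_apply_univ] at h
        refine h.trans ?_
        rw [← mul_assoc]
        gcongr
        push_cast
        exact le_add_self
    · refine ⟨fun l => if l = 0 then openSimplexOf s T else ∅, fun _ => 1, fun l => ?_,
        fun l => ?_, fun x hx hxT => ⟨0, by simpa using hxT⟩, fun l => ?_, fun b => ?_⟩
      · dsimp only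
        split_ifs
        exacts [measurableSet_openSimplexOf hs T, MeasurableSet.empty]
      · dsimp only
        split_ifs
        exacts [subset_rfl, empty_subset _]
      · have heq : ∀ x ∈ if l = 0 then openSimplexOf s T else ∅, radialStep k a x = x := by
          intro x hx
          split_ifs at hx
          · obtain ⟨-, rfl⟩ := (mem_openSimplexOf_iff hs).1 hx
            simp [radialStep, hT]
          · exact hx.elim
        intro x hx y hy
        rw [heq x hx, heq y hy]
        simp
      · rw [tsum_eq_single 0 fun l hl => by simp [hl]]
        simp only [if_true, ENNReal.coe_one, one_pow]
        gcongr
        push_cast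
        exact le_self_add
  choose A d hAm hAT hAc hAl hAs using hpiece
  refine ⟨radialStep k a, fun S hS x hx => ?_, ?_, fun x hx => ?_,
    Finset I × ℕ, inferInstance, fun p => A p.1 p.2, fun p => d p.1 p.2, fun p => hAm _ _,
    fun x hx => ?_, fun p => hAl _ _, fun b T => ?_⟩
  · rw [mem_simplexOf_iff hs] at hx ⊢
    exact ⟨(hstep hx.1).1, (hstep hx.1).2.1.trans hx.2⟩
  · exact exists_lipschitzOnWith_radialStep hσ (η := σ / (2 * (N + 1))) (by positivity) hZ hZb
      fun T hT => ⟨hab T hT, hav T hT, haη T hT, haZ T hT⟩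
  · obtain ⟨hb, hF, hc⟩ := (mem_skeleton_iff hs K).1 (hZK hx)
    obtain ⟨h1, h2, h3⟩ := hstep hb
    rw [mem_skeleton_iff hs]
    refine ⟨h1, K.down_closed _ hF _ h2 (h1.vsupp_nonempty hσ), ?_⟩
    by_cases hcard : (vsupp x).card = k + 1
    · have := Finset.card_lt_card (h3 hcard fun h => haZ _ hcard (h ▸ hx))
      omega
    · have := Finset.card_le_card h2
      omega
  · obtain ⟨l, hl⟩ := hAc (vsupp x) x hx ((mem_openSimplexOf_iff hs).2 ⟨(hZb x hx).1, rfl⟩)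
    exact ⟨(vsupp x, l), hl⟩
  · rw [ENNReal.tsum_prod']
    have hle : ∀ S : Finset I, ∑' l, (d S l : ℝ≥0∞) ^ n * μ b (A S l ∩ openStar s K T) ≤
        (1 + 2 * centerConst n N : ℝ≥0) * μ b (openSimplexOf s S ∩ openStar s K T) := by
      intro S
      by_cases hST : S ∈ K.F ∧ T ⊆ S
      · have hsub : openSimplexOf s S ⊆ openStar s K T := fun x hx => by
          obtain ⟨h, rfl⟩ := (mem_openSimplexOf_iff hs).1 hx
          exact (mem_openStar_iff hs K).2 ⟨h, hST⟩
        rw [inter_eq_left.2 hsub]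
        refine le_trans ?_ (hAs S b)
        gcongr
        exact inter_subset_left
      · have hemp : openSimplexOf s S ∩ openStar s K T = ∅ := by
          refine eq_empty_of_forall_notMem fun x hx => hST ?_
          obtain ⟨h, rfl⟩ := (mem_openSimplexOf_iff hs).1 hx.1
          exact ((mem_openStar_iff hs K).1 hx.2).2
        have : ∀ l, A S l ∩ openStar s K T = ∅ := fun l =>
          subset_empty_iff.1 (hemp ▸ inter_subset_inter_left _ (hAT S l))
        simp [this]
    refine (ENNReal.tsum_le_tsum hle).trans ?_
    rw [ENNReal.tsum_mul_left]
    gcongr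
    refine (tsum_meas_le_meas_iUnion_of_disjoint (μ b)
      (fun S => (measurableSet_openSimplexOf hs S).inter (measurableSet_openStar hs K T))
      fun S S' hne => ?_).trans (measure_mono (iUnion_subset fun S => inter_subset_right))
    refine Set.disjoint_left.2 fun x hx hx' => hne ?_
    exact ((mem_openSimplexOf_iff hs).1 hx.1).2.symm.trans ((mem_openSimplexOf_iff hs).1 hx'.1).2

end SkeletonStep
section Iteration

variable {I : Type} [Fintype I] [DecidableEq I] {s : ℝ}

theorem exists_map_to_skeleton (hs : 0 < s) (K : SimplicialCplx I) {n N : ℕ}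
    (hK : ∀ S ∈ K.F, S.card ≤ N + 1) {Z : Set (EuclideanSpace ℝ I)} (hZ : IsCompact Z)
    (hZK : Z ⊆ realization s K) (hZn : μH[(n : ℝ)] Z ≠ ∞) {Y : Bool → Type}
    [∀ b, MetricSpace (Y b)] [∀ b, MeasurableSpace (Y b)] [∀ b, BorelSpace (Y b)]
    {f : ∀ b, Y b → EuclideanSpace ℝ I} (hf : ∀ b, Continuous (f b)) (hfZ : ∀ b y, f b y ∈ Z)
    (ω₀ : ∀ b, Measure (Y b)) [∀ b, SFinite (ω₀ b)]
    (hω₀ : ∀ b, PiecewiseDominated n (f b) (ω₀ b)) (j : ℕ) (hj : j ≤ N - n) :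
    ∃ p : EuclideanSpace ℝ I → EuclideanSpace ℝ I,
      (∀ S ∈ K.F, ∀ x ∈ simplexOf s S, p x ∈ simplexOf s S) ∧
      (∃ c : ℝ≥0, LipschitzOnWith c p Z) ∧ (∀ x ∈ Z, p x ∈ skeleton s K (N - j)) ∧
      ∀ b, ∃ ω : Measure (Y b), SFinite ω ∧ PiecewiseDominated n (p ∘ f b) ω ∧
        ∀ T, ω ((p ∘ f b) ⁻¹' openStar s K T) ≤
          ((1 + 2 * centerConst n N) ^ j : ℝ≥0) * ω₀ b (f b ⁻¹' openStar s K T) := by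
  induction j with
  | zero =>
    refine ⟨id, fun S _ x hx => hx, ⟨1, LipschitzWith.id.lipschitzOnWith⟩, fun x hx => ?_,
      fun b => ⟨ω₀ b, inferInstance, hω₀ b, fun T => by simp⟩⟩
    obtain ⟨h1, h2⟩ := (mem_realization_iff hs K).1 (hZK hx)
    exact (mem_skeleton_iff hs K).2 ⟨h1, h2, hK _ h2⟩
  | succ j ih =>
    obtain ⟨p, hpS, ⟨c, hpc⟩, hpK, hω⟩ := ih (by omega)
    choose ω hωs hωd hωT using hω
    have hcont : ∀ b, Continuous (p ∘ f b) := fun b =>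
      hpc.continuousOn.comp_continuous (hf b) (hfZ b)
    have hnull : μH[((N - j : ℕ) : ℝ)] (p '' Z) = 0 := by
      have h := hpc.hausdorffMeasure_image_le (Nat.cast_nonneg (N - j))
      have hlt : (n : ℝ) < ((N - j : ℕ) : ℝ) := by
        exact_mod_cast (by omega : n < N - j)
      rw [(Measure.hausdorffMeasure_zero_or_top hlt Z).resolve_right hZn, mul_zero] at h
      exact le_antisymm h zero_le
    obtain ⟨q, hqS, ⟨c', hqc⟩, hqK, κ, hκ, A, d, hAm, hAc, hAl, hAs⟩ :=
      exists_skeleton_step hs K (by omega : n < N - j) (Nat.sub_le N j)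
        (hZ.image_of_continuousOn hpc.continuousOn) (image_subset_iff.2 hpK) hnull
        fun b => (ω b).map (p ∘ f b)
    refine ⟨q ∘ p, fun S hS x hx => hqS S hS _ (hpS S hS x hx),
      ⟨c' * c, hqc.comp hpc (mapsTo_image p Z)⟩, fun x hx => ?_, fun b => ?_⟩
    · exact hqK _ (mem_image_of_mem p hx)
    · refine ⟨Measure.sum fun l => (d l ^ n) • (ω b).restrict ((p ∘ f b) ⁻¹' A l), inferInstance,
        (hωd b).comp (hcont b).measurable hAm
          (fun y => hAc _ (mem_image_of_mem p (hfZ b y))) hAl, fun T => ?_⟩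
      have hsub : ((q ∘ p) ∘ f b) ⁻¹' openStar s K T ⊆ (p ∘ f b) ⁻¹' openStar s K T := by
        intro y hy
        obtain ⟨h1, h2, -⟩ := (mem_skeleton_iff hs K).1 (hpK _ (hfZ b y))
        refine (mem_openStar_iff hs K).2 ⟨h1, h2, ?_⟩
        refine ((mem_openStar_iff hs K).1 hy).2.2.trans ?_
        exact ((mem_simplexOf_iff hs).1
          (hqS _ h2 _ ((mem_simplexOf_iff hs).2 ⟨h1, subset_rfl⟩))).2
      have hm := (hcont b).measurable (measurableSet_openStar hs K T)
      refine (measure_mono hsub).trans ?_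
      rw [Measure.sum_apply _ hm]
      have hterm : ∀ l, ((d l ^ n) • (ω b).restrict ((p ∘ f b) ⁻¹' A l))
          ((p ∘ f b) ⁻¹' openStar s K T) =
          (d l : ℝ≥0∞) ^ n * (ω b).map (p ∘ f b) (A l ∩ openStar s K T) := by
        intro l
        rw [Measure.map_apply (hcont b).measurable
          ((hAm l).inter (measurableSet_openStar hs K T)), Measure.smul_apply,
          Measure.restrict_apply hm, ENNReal.smul_def, ENNReal.coe_pow, smul_eq_mul,
          inter_comm, preimage_inter]
      simp only [hterm]
      refine (hAs b T).trans ?_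
      rw [Measure.map_apply (hcont b).measurable (measurableSet_openStar hs K T)]
      refine (mul_le_mul_right (hωT b T) _).trans_eq ?_
      rw [← mul_assoc, ← ENNReal.coe_mul, pow_succ']

theorem hausdorffMeasure_simplexOf_eq_zero (hs : 0 < s) {n : ℕ} {T : Finset I}
    (hT : T.card ≤ n) : μH[(n : ℝ)] (simplexOf s T) = 0 := by
  obtain rfl | ⟨i₀, hi₀⟩ := T.eq_empty_or_nonempty
  · simp [simplexOf]
  have hsmooth : ContDiff ℝ 1 (centerOf (s / √2) T i₀) := by
    refine contDiff_euclidean.2 fun i => ?_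
    unfold centerOf
    refine ContDiff.add ?_ ?_
    · split_ifs <;> fun_prop
    · split_ifs <;> fun_prop
  have hsub : simplexOf s T ⊆ range (centerOf (s / √2) T i₀) := by
    intro x hx
    obtain ⟨hb, hx⟩ := (mem_simplexOf_iff hs).1 hx
    rw [vsupp_subset_iff] at hx
    have hsum := hb.2
    have hsum' : ∑ j : T.erase i₀, x j = ∑ i ∈ T.erase i₀, x i :=
      Finset.sum_coe_sort (T.erase i₀) fun i => x i
    have htot : ∑ i ∈ T, x i = ∑ i, x i :=
      Finset.sum_subset (Finset.subset_univ T) fun i _ hi => hx i hi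
    rw [← Finset.add_sum_erase T _ hi₀] at htot
    refine ⟨fun i => x i, ?_⟩
    ext i
    by_cases hi : i ∈ T
    · by_cases h : i = i₀
      · subst h
        rw [centerOf_apply_self]
        linarith
      · exact centerOf_apply_of_mem _ ⟨i, Finset.mem_erase.2 ⟨h, hi⟩⟩
    · rw [centerOf_apply_of_notMem hi₀ _ hi, hx i hi]
  refine measure_mono_null hsub ?_
  rw [← NNReal.coe_natCast]
  refine hausdorffMeasure_of_dimH_lt ?_
  refine hsmooth.dimH_range_le.trans_lt ?_
  rw [Module.finrank_fintype_fun_eq_card, Fintype.card_coe, Finset.card_erase_of_mem hi₀]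
  have := Finset.card_pos.2 ⟨i₀, hi₀⟩
  exact_mod_cast (by omega : T.card - 1 < n)

theorem hausdorffMeasure_simplexOf_diff_openSimplexOf (hs : 0 < s) {n : ℕ} {S : Finset I}
    (hS : S.card = n + 1) : μH[(n : ℝ)] (simplexOf s S \ openSimplexOf s S) = 0 := by
  refine measure_mono_null (t := ⋃ T ∈ S.ssubsets, simplexOf s T) (fun x hx => ?_)
    ((measure_biUnion_null_iff S.ssubsets.countable_toSet).2 fun T hT => ?_)
  · obtain ⟨hb, h⟩ := (mem_simplexOf_iff hs).1 hx.1
    refine mem_biUnion (Finset.mem_ssubsets.2 (h.ssubset_of_ne fun he => ?_))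
      ((mem_simplexOf_iff hs).2 ⟨hb, subset_rfl⟩)
    exact hx.2 ((mem_openSimplexOf_iff hs).2 ⟨hb, he⟩)
  · have := Finset.card_lt_card (Finset.mem_ssubsets.1 hT)
    exact hausdorffMeasure_simplexOf_eq_zero hs (by omega)

end Iteration
section Pair

variable {I : Type} [Fintype I] [DecidableEq I] {s : ℝ}

/-- Two spaces mapping to the same complex can be pushed to the `n`-skeleton simultaneously. -/
theorem exists_map_to_skeleton_pair (hs : 0 < s) (K : SimplicialCplx I) {n N : ℕ} (hnN : n ≤ N)
    (hK : ∀ S ∈ K.F, S.card ≤ N + 1) {Z : Set (EuclideanSpace ℝ I)} (hZ : IsCompact Z)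
    (hZK : Z ⊆ realization s K) (hZn : μH[(n : ℝ)] Z ≠ ∞) {X Y : Type}
    [iX : MetricSpace X] [mX : MeasurableSpace X] [bX : BorelSpace X]
    [iY : MetricSpace Y] [mY : MeasurableSpace Y] [bY : BorelSpace Y]
    {f : X → EuclideanSpace ℝ I} {g : Y → EuclideanSpace ℝ I} (hf : Continuous f)
    (hg : Continuous g) (hfZ : ∀ x, f x ∈ Z) (hgZ : ∀ y, g y ∈ Z) (μ : Measure X) (ν : Measure Y)
    [hμ : SFinite μ] [hν : SFinite ν] (hfμ : PiecewiseDominated n f μ)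
    (hgν : PiecewiseDominated n g ν) :
    ∃ p : EuclideanSpace ℝ I → EuclideanSpace ℝ I,
      (∀ S ∈ K.F, ∀ x ∈ simplexOf s S, p x ∈ simplexOf s S) ∧
      (∃ c : ℝ≥0, LipschitzOnWith c p Z) ∧ (∀ x ∈ Z, p x ∈ skeleton s K n) ∧
      (∃ ω : Measure X, PiecewiseDominated n (p ∘ f) ω ∧
        ∀ T, ω ((p ∘ f) ⁻¹' openStar s K T) ≤
          ((1 + 2 * centerConst n N) ^ (N - n) : ℝ≥0) * μ (f ⁻¹' openStar s K T)) ∧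
      ∃ ω : Measure Y, PiecewiseDominated n (p ∘ g) ω ∧
        ∀ T, ω ((p ∘ g) ⁻¹' openStar s K T) ≤
          ((1 + 2 * centerConst n N) ^ (N - n) : ℝ≥0) * ν (g ⁻¹' openStar s K T) := by
  let W : Bool → Type := fun b => Bool.rec Y X b
  let iW : ∀ b, MetricSpace (W b) := fun b => Bool.rec iY iX b
  let mW : ∀ b, MeasurableSpace (W b) := fun b => Bool.rec mY mX b
  have bW : ∀ b, @BorelSpace (W b)
      (iW b).toPseudoMetricSpace.toUniformSpace.toTopologicalSpace (mW b) := by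
    rintro (_ | _)
    exacts [bY, bX]
  let h : ∀ b, W b → EuclideanSpace ℝ I := fun b => Bool.rec g f b
  let ω₀ : ∀ b, @Measure (W b) (mW b) := fun b => Bool.rec ν μ b
  have sW : ∀ b, @SFinite (W b) (mW b) (ω₀ b) := by
    rintro (_ | _)
    exacts [hν, hμ]
  have hh : ∀ b, @Continuous (W b) _ (iW b).toPseudoMetricSpace.toUniformSpace.toTopologicalSpace
      _ (h b) := by
    rintro (_ | _)
    exacts [hg, hf]
  have hhZ : ∀ b y, h b y ∈ Z := by
    rintro (_ | _)
    exacts [hgZ, hfZ]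
  have hhω : ∀ b, @PiecewiseDominated n (W b) _ (iW b) (mW b) (bW b) _ (h b) (ω₀ b) := by
    rintro (_ | _)
    exacts [hgν, hfμ]
  obtain ⟨p, hpS, hpc, hpK, hω⟩ := @exists_map_to_skeleton I _ _ s hs K n N hK Z hZ hZK hZn W iW mW
    bW h hh hhZ ω₀ sW hhω (N - n) le_rfl
  rw [Nat.sub_sub_self hnN] at hpK
  obtain ⟨ω₁, -, h₁⟩ := hω true
  obtain ⟨ω₂, -, h₂⟩ := hω false
  exact ⟨p, hpS, hpc, hpK, ⟨ω₁, h₁⟩, ω₂, h₂⟩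

end Pair

/-- (Projection to the `n`-skeleton with multiplicity control.)
Let `X` be compact with finite `H^n`-measure, `Σ` a finite simplicial complex of dimension
`N ≥ n` with the `ℓ²`-metric, `P ⊆ X` purely `n`-unrectifiable, and `φ : X → Σ`
`L`-Lipschitz with `H^n(φ(P)) ≤ ε`. Then there is `p : Σ → Σ` with `p(Δ) ⊆ Δ` for each
simplex, `p ∘ φ` Lipschitz with image in the `n`-skeleton, `H^n(p(φ(P))) ≤ C·ε`, and
`∫_Δ N(p ∘ φ, y) dH^n(y) ≤ C·H^n(φ⁻¹(st Δ))` for each `n`-dimensional simplex `Δ`,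
where `C > 1` depends only on `L`, `N` and `n`. -/
theorem stmt3 (n N : ℕ) (hnN : n ≤ N) (L : ℝ≥0) :
    ∃ C : ℝ≥0, 1 < C ∧
      ∀ (X : Type) [MetricSpace X] [CompactSpace X] [MeasurableSpace X] [BorelSpace X],
        μH[(n : ℝ)] (Set.univ : Set X) < ⊤ →
        ∀ (m : ℕ) (K : SimplicialCplx (Fin m)) (s : ℝ), 0 < s →
          -- `Σ` has dimension at most `N`
          (∀ S ∈ K.F, S.card ≤ N + 1) →
          ∀ (P : Set X), PurelyUnrectifiable n P →
          ∀ (φ : X → EuclideanSpace ℝ (Fin m)),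
            LipschitzWith L φ → (∀ x, φ x ∈ realization s K) →
          ∀ (ε : ℝ), 0 < ε → μH[(n : ℝ)] (φ '' P) ≤ ENNReal.ofReal ε →
          ∃ p : EuclideanSpace ℝ (Fin m) → EuclideanSpace ℝ (Fin m),
            -- `p(Δ) ⊆ Δ` for each simplex of `Σ`
            (∀ S ∈ K.F, ∀ x ∈ simplexOf s S, p x ∈ simplexOf s S) ∧
            -- `p ∘ φ` is Lipschitz
            (∃ L' : ℝ≥0, LipschitzWith L' (p ∘ φ)) ∧
            -- with image in the `n`-skeleton
            (∀ x : X, p (φ x) ∈ skeleton s K n) ∧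
            -- `H^n(p(φ(P))) ≤ C·ε`
            μH[(n : ℝ)] (p '' (φ '' P)) ≤ ENNReal.ofReal ((C : ℝ) * ε) ∧
            -- multiplicity bound over each `n`-dimensional simplex
            (∀ S ∈ K.F, S.card = n + 1 →
              ∫⁻ y in simplexOf s S, (((p ∘ φ) ⁻¹' {y}).encard : ℝ≥0∞)
                  ∂(μH[(n : ℝ)] : Measure (EuclideanSpace ℝ (Fin m))) ≤
                (C : ℝ≥0∞) * μH[(n : ℝ)] (φ ⁻¹' openStar s K S)) := by
  set D : ℝ≥0 := (1 + 2 * centerConst n N) ^ (N - n) with hD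
  have hDpos : 0 < D := by positivity
  refine ⟨(L ^ n + 1) * D + 1, by simp; positivity, ?_⟩
  intro X _ _ _ _ hX m K s hs hK P _ φ hφ hφK ε hε hP
  have hXfin : IsFiniteMeasure (μH[(n : ℝ)] : Measure X) := ⟨hX⟩
  have hZn : μH[(n : ℝ)] (range φ) ≠ ∞ := by
    rw [← image_univ]
    refine ((hφ.lipschitzOnWith).hausdorffMeasure_image_le n.cast_nonneg).trans_lt ?_ |>.ne
    exact ENNReal.mul_lt_top (by simp) hX
  have hcpt : IsCompact (range φ) := isCompact_range hφ.continuous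
  set G : Set (EuclideanSpace ℝ (Fin m)) := toMeasurable μH[(n : ℝ)] (φ '' P) ∩ range φ with hG
  have hPG : φ '' P ⊆ G := subset_inter (subset_toMeasurable _ _) (image_subset_range φ P)
  have hGε : μH[(n : ℝ)] (univ : Set G) ≤ ENNReal.ofReal ε := by
    rw [← isometry_subtype_coe.hausdorffMeasure_image (Or.inl n.cast_nonneg), image_univ,
      Subtype.range_coe]
    exact (measure_mono inter_subset_left).trans ((measure_toMeasurable _).trans_le hP)
  have hGfin : IsFiniteMeasure (μH[(n : ℝ)] : Measure G) := ⟨hGε.trans_lt ENNReal.ofReal_lt_top⟩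
  obtain ⟨p, hpS, ⟨c, hpc⟩, hpK, ⟨ω₁, hω₁, h₁⟩, ω₂, hω₂, h₂⟩ :=
    exists_map_to_skeleton_pair hs K hnN hK hcpt (range_subset_iff.2 hφK) hZn hφ.continuous
      (continuous_subtype_val (p := fun y => y ∈ G)) (mem_range_self (f := φ)) (fun y => y.2.2) _ _
      (PiecewiseDominated.of_lipschitzWith (n := n) hφ)
      (PiecewiseDominated.of_lipschitzWith (n := n) (LipschitzWith.subtype_val G))
  have hpφ : LipschitzWith (c * L) (p ∘ φ) := by
    rw [← lipschitzOnWith_univ]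
    exact hpc.comp hφ.lipschitzOnWith fun x _ => mem_range_self x
  refine ⟨p, hpS, ⟨_, hpφ⟩, fun x => hpK _ (mem_range_self x), ?_, fun S _ hS => ?_⟩
  · calc μH[(n : ℝ)] (p '' (φ '' P))
        ≤ μH[(n : ℝ)] (range (p ∘ (Subtype.val : G → _))) := by
          rw [range_comp, Subtype.range_coe]
          exact measure_mono (image_mono hPG)
      _ ≤ ω₂ univ := hω₂.hausdorffMeasure_range_le
      _ ≤ ω₂ ((p ∘ Subtype.val) ⁻¹' openStar s K ∅) := by
          refine measure_mono fun y _ => (mem_openStar_iff hs K).2 ?_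
          obtain ⟨ha, hb, -⟩ := (mem_skeleton_iff hs K).1 (hpK _ y.2.2)
          exact ⟨ha, hb, Finset.empty_subset _⟩
      _ ≤ D * ENNReal.ofReal ε := by
          refine (h₂ ∅).trans ?_
          rw [one_pow, one_smul]
          gcongr
          exact (measure_mono (subset_univ _)).trans hGε
      _ ≤ _ := by
          rw [ENNReal.ofReal_mul (by positivity), ENNReal.ofReal_coe_nnreal]
          gcongr
          refine le_add_of_le_of_nonneg ?_ zero_le
          exact le_mul_of_one_le_left zero_le le_add_self
  · calc ∫⁻ y in simplexOf s S, (((p ∘ φ) ⁻¹' {y}).encard : ℝ≥0∞) ∂μH[(n : ℝ)]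
        ≤ ∫⁻ y in openSimplexOf s S ∪ (simplexOf s S \ openSimplexOf s S),
            (((p ∘ φ) ⁻¹' {y}).encard : ℝ≥0∞) ∂μH[(n : ℝ)] := by
          refine lintegral_mono_set ?_
          rw [union_sdiff_self]
          exact subset_union_right
      _ ≤ ∫⁻ y in openSimplexOf s S, (((p ∘ φ) ⁻¹' {y}).encard : ℝ≥0∞) ∂μH[(n : ℝ)] + 0 := by
          refine (lintegral_union_le _ _ _).trans_eq ?_
          rw [setLIntegral_measure_zero (simplexOf s S \ openSimplexOf s S) _
            (hausdorffMeasure_simplexOf_diff_openSimplexOf hs hS)]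
      _ ≤ ω₁ ((p ∘ φ) ⁻¹' openSimplexOf s S) := by
          rw [add_zero]
          exact hω₁.lintegral_encard_le hpφ.continuous.measurable
            (measurableSet_openSimplexOf hs S)
      _ ≤ ω₁ ((p ∘ φ) ⁻¹' openStar s K S) := by
          refine measure_mono fun x hx => ?_
          obtain ⟨ha, hb, -⟩ := (mem_skeleton_iff hs K).1 (hpK _ (mem_range_self x))
          exact (mem_openStar_iff hs K).2
            ⟨ha, hb, ((mem_openSimplexOf_iff hs).1 hx).2.ge⟩
      _ ≤ D * ((L ^ n : ℝ≥0) * μH[(n : ℝ)] (φ ⁻¹' openStar s K S)) := by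
          refine (h₁ S).trans_eq ?_
          rw [Measure.smul_apply, ENNReal.smul_def, smul_eq_mul]
      _ ≤ _ := by
          rw [← mul_assoc]
          gcongr
          rw [← ENNReal.coe_mul, ENNReal.coe_le_coe, mul_comm]
          refine le_add_of_le_of_nonneg ?_ zero_le
          gcongr
          exact le_self_add
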